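/- arXiv:2309.04838 — 2 statements merged into one kernel-verified Lean document; each statement's English description precedes it below -/
import Mathlib

section
/- As rational numbers, the sum of 1/φ(ord(g)) over all non-identity elements g ∈ G_n with π₀(q_n(g)) = 0 (where φ is Euler's totient function and ord(g) is the order of g) equals (9^n − 1)/3 + (27^n − 1)/6. -/
/-- The abelian group `A_n = ℤ/3 ⊕ (ℤ/9)^n`. -/
abbrev An (n : ℕ) : Type := ZMod 3 × (Fin n → ZMod 9)

/-- Projection onto the `ℤ/3` factor. -/
def pi0 {n : ℕ} (a : An n) : ZMod 3 := a.1

/-- The reduction map `ℤ/9 → ℤ/3`. -/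
def red : ZMod 9 →+* ZMod 3 := ZMod.castHom (show 3 ∣ 9 by norm_num) (ZMod 3)

/-- The `i`-th `ℤ/9` coordinate reduced mod 3. -/
def pii {n : ℕ} (i : Fin n) (a : An n) : ZMod 3 := red (a.2 i)

/-- The 2-cocycle `θ(σ,τ) i = π₀(σ)·π_i(τ)`. -/
def theta {n : ℕ} (σ τ : An n) : Fin n → ZMod 3 := fun i => pi0 σ * pii i τ

/-- The underlying set of the group `G_n`. -/
def Gn (n : ℕ) : Type := (Fin n → ZMod 3) × An n

namespace Gn

variable {n : ℕ}

instance instFintype : Fintype (Gn n) :=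
  inferInstanceAs (Fintype ((Fin n → ZMod 3) × An n))

instance instDecEq : DecidableEq (Gn n) :=
  inferInstanceAs (DecidableEq ((Fin n → ZMod 3) × An n))

lemma theta_add_left (a b c : An n) : theta (a + b) c = theta a c + theta b c := by
  funext i; simp only [theta, pi0, Pi.add_apply, Prod.fst_add]; ring

lemma theta_add_right (a b c : An n) : theta a (b + c) = theta a b + theta a c := by
  funext i
  simp only [theta, pii, pi0, Pi.add_apply, Prod.snd_add, map_add]
  ring

lemma theta_zero_left (a : An n) : theta 0 a = 0 := by
  funext i; simp [theta, pi0]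

lemma theta_zero_right (a : An n) : theta a 0 = 0 := by
  funext i; simp [theta, pii]

lemma theta_neg_left (a b : An n) : theta (-a) b = - theta a b := by
  funext i; simp only [theta, pi0, Prod.fst_neg, Pi.neg_apply]; ring

/-- The group structure on `G_n` given by the cocycle `θ`. -/
instance instGroup : Group (Gn n) where
  mul x y := (x.1 + y.1 + theta x.2 y.2, x.2 + y.2)
  one := (0, 0)
  inv x := (-x.1 + theta x.2 x.2, -x.2)
  mul_assoc x y z := by
    apply Prod.ext
    · show x.1 + y.1 + theta x.2 y.2 + z.1 + theta (x.2 + y.2) z.2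
        = x.1 + (y.1 + z.1 + theta y.2 z.2) + theta x.2 (y.2 + z.2)
      rw [theta_add_left, theta_add_right]; abel
    · exact add_assoc _ _ _
  one_mul x := by
    apply Prod.ext
    · show 0 + x.1 + theta 0 x.2 = x.1
      rw [theta_zero_left]; abel
    · exact zero_add _
  mul_one x := by
    apply Prod.ext
    · show x.1 + 0 + theta x.2 0 = x.1
      rw [theta_zero_right]; abel
    · exact add_zero _
  inv_mul_cancel x := by
    apply Prod.ext
    · show -x.1 + theta x.2 x.2 + x.1 + theta (-x.2) x.2 = 0
      rw [theta_neg_left]; abel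
    · exact neg_add_cancel _

/-- The quotient map `q_n : G_n → A_n`, `(c, a) ↦ a`. -/
def qn (x : Gn n) : An n := x.2

lemma qn_mul (x y : Gn n) : qn (x * y) = qn x + qn y := rfl

/-- `q_n` as a group homomorphism to (the multiplicative version of) `A_n`. -/
def qnHom : Gn n →* Multiplicative (An n) where
  toFun x := Multiplicative.ofAdd (qn x)
  map_one' := rfl
  map_mul' _ _ := rfl

end Gn

/-- The element `(c, (0, x))` of `G_n`. -/
def gmk {n : ℕ} (c : Fin n → ZMod 3) (x : Fin n → ZMod 9) : Gn n := (c, ((0 : ZMod 3), x))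

lemma pow_of_pi0 {n : ℕ} (c : Fin n → ZMod 3) (x : Fin n → ZMod 9) (k : ℕ) :
    (gmk c x) ^ k = gmk (k • c) (k • x) := by
  induction k with
  | zero => simp only [pow_zero, zero_smul]; rfl
  | succ k ih =>
    rw [pow_succ, ih]
    apply Prod.ext
    · show k • c + c + theta ((0 : ZMod 3), k • x) ((0 : ZMod 3), x) = (k + 1) • c
      have : theta ((0 : ZMod 3), k • x) ((0 : ZMod 3), x) = 0 := by
        funext i; simp [theta, pi0]
      rw [this, add_zero, succ_nsmul]
    · show (((0 : ZMod 3), k • x) : An n) + ((0 : ZMod 3), x) = ((0 : ZMod 3), (k + 1) • x)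
      rw [Prod.mk_add_mk, add_zero, succ_nsmul]

lemma mk_eq_one_iff {n : ℕ} (c : Fin n → ZMod 3) (x : Fin n → ZMod 9) :
    gmk c x = (1 : Gn n) ↔ c = 0 ∧ x = 0 := by
  constructor
  · intro h
    have h1 : c = 0 := congrArg (fun g : Gn n => g.1) h
    have h2 : x = 0 := congrArg (fun g : Gn n => g.2.2) h
    exact ⟨h1, h2⟩
  · rintro ⟨rfl, rfl⟩; rfl

lemma term_eq {n : ℕ} (c : Fin n → ZMod 3) (x : Fin n → ZMod 9)
    (hg : gmk c x ≠ (1 : Gn n)) :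
    (1 : ℚ) / (Nat.totient (orderOf (gmk c x)) : ℚ)
      = 1 / 6 + if (∀ i, 3 * x i = 0) then (1 / 3 : ℚ) else 0 := by
  have hc3 : (3 : ℕ) • c = 0 := by
    funext i; simp only [Pi.smul_apply, Pi.zero_apply]; generalize c i = y; revert y; decide
  have hp3 : (gmk c x) ^ 3 = (1 : Gn n) ↔ ∀ i, 3 * x i = 0 := by
    rw [pow_of_pi0, mk_eq_one_iff]
    simp only [hc3, true_and, funext_iff, Pi.zero_apply, nsmul_eq_mul,
      Nat.cast_ofNat]
    exact Iff.rfl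
  have hp9 : (gmk c x) ^ 9 = (1 : Gn n) := by
    rw [pow_of_pi0, mk_eq_one_iff]
    constructor
    · funext i; simp only [Pi.smul_apply, Pi.zero_apply]; generalize c i = y; revert y; decide
    · funext i; simp only [Pi.smul_apply, Pi.zero_apply]; generalize x i = y; revert y; decide
  have hprime : Fact (Nat.Prime 3) := ⟨Nat.prime_three⟩
  split_ifs with h
  · rw [orderOf_eq_prime (hp3.2 h) hg, Nat.totient_prime Nat.prime_three]; norm_num
  · have : orderOf (gmk c x) = 3 ^ (1 + 1) :=
      orderOf_eq_prime_pow (by simpa using fun h' => h (hp3.1 h')) (by simpa using hp9)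
    rw [this, Nat.totient_prime_pow Nat.prime_three (by norm_num)]; norm_num

lemma card_three {n : ℕ} :
    (Finset.univ.filter (fun x : Fin n → ZMod 9 => ∀ i, 3 * x i = 0)).card = 3 ^ n := by
  have : (Finset.univ.filter (fun x : Fin n → ZMod 9 => ∀ i, 3 * x i = 0))
      = Fintype.piFinset (fun _ => Finset.univ.filter (fun y : ZMod 9 => 3 * y = 0)) := by
    ext x; simp [Fintype.mem_piFinset]
  rw [this, Fintype.card_piFinset_const]
  have h : (Finset.univ.filter (fun y : ZMod 9 => 3 * y = 0)).card = 3 := by decide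
  rw [h]

/-- As rational numbers,
`∑ 1/φ(ord g)` over all non-identity `g ∈ G_n` with `π₀(q_n(g)) = 0` equals
`(9^n − 1)/3 + (27^n − 1)/6`. -/
theorem stmt_9 (n : ℕ) (hn : 1 ≤ n) :
    ∑ g ∈ Finset.univ.filter (fun g : Gn n => g ≠ 1 ∧ pi0 (Gn.qn g) = 0),
        (1 : ℚ) / (Nat.totient (orderOf g) : ℚ)
      = ((9 : ℚ) ^ n - 1) / 3 + ((27 : ℚ) ^ n - 1) / 6 := by
  have key : ∑ g ∈ Finset.univ.filter (fun g : Gn n => g ≠ 1 ∧ pi0 (Gn.qn g) = 0),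
        (1 : ℚ) / (Nat.totient (orderOf g) : ℚ)
      = ∑ p ∈ (Finset.univ : Finset ((Fin n → ZMod 3) × (Fin n → ZMod 9))).erase (0, 0),
        (1 / 6 + if (∀ i, 3 * p.2 i = 0) then (1 / 3 : ℚ) else 0) := by
    symm
    refine Finset.sum_bij (fun p _ => gmk p.1 p.2) ?_ ?_ ?_ ?_
    · rintro ⟨c, x⟩ hp
      rw [Finset.mem_filter]
      refine ⟨Finset.mem_univ _, fun h => ?_, rfl⟩
      obtain ⟨rfl, rfl⟩ := (mk_eq_one_iff c x).1 h
      simp at hp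
    · rintro ⟨c, x⟩ _ ⟨d, y⟩ _ h
      have h1 : c = d := congrArg (fun g : Gn n => g.1) h
      have h2 : x = y := congrArg (fun g : Gn n => g.2.2) h
      rw [h1, h2]
    · intro g hg
      rw [Finset.mem_filter] at hg
      obtain ⟨_, h1, h2⟩ := hg
      obtain ⟨c, z, x⟩ := g
      have hz : z = 0 := h2
      subst hz
      refine ⟨(c, x), ?_, rfl⟩
      rw [Finset.mem_erase]
      refine ⟨fun h => h1 ?_, Finset.mem_univ _⟩
      rw [Prod.mk.injEq] at h
      exact (mk_eq_one_iff c x).2 h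
    · rintro ⟨c, x⟩ hp
      refine (term_eq c x fun h => ?_).symm
      obtain ⟨rfl, rfl⟩ := (mk_eq_one_iff c x).1 h
      simp at hp
  rw [key, Finset.sum_erase_eq_sub (Finset.mem_univ _), Fintype.sum_prod_type]
  simp only [Finset.sum_add_distrib, ← Finset.sum_filter, Finset.sum_const, card_three,
    Finset.card_univ, Fintype.card_fun, ZMod.card, Fintype.card_fin, nsmul_eq_mul]
  have h27 : (27 : ℚ) ^ n = 3 ^ n * 9 ^ n := by rw [← mul_pow]; norm_num
  have h9 : (9 : ℚ) ^ n = 3 ^ n * 3 ^ n := by rw [← mul_pow]; norm_num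
  simp only [Pi.zero_apply, mul_zero, implies_true, if_true]
  rw [h27, h9]
  push_cast
  rw [h9]
  ring
end

section
/- Let α := (9^n − 1)/3 + (27^n − 1)/6 (a positive integer for n ≥ 1) and let f_n be the multiplicative function supported on squarefree integers with f_n(p) = w_n(p) on primes, where w_n(p) := 9^n − 1 if p ≡ 4 or 7 (mod 9), w_n(p) := 27^n − 1 if p ≡ 1 (mod 9), and w_n(p) := 0 otherwise. Then the partial Euler products ∏_{p ≤ N, p prime} (1 + w_n(p)/p) * (1 − 1/p)^α converge as N → ∞ to a positive real number c₀, and the number of tuples in 𝒢_{n,bad} with total product at most X is asymptotic, as X → ∞, to 2 * 27^n * c₀ * X * (log X)^(α − 1) / (3 * Γ(α)), where Γ is the Gamma function. -/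
/-- The weight `w_n(p)`: `9^n − 1` if `p ≡ 4, 7 (mod 9)`, `27^n − 1` if
`p ≡ 1 (mod 9)`, and `0` otherwise. -/
def wn (n p : ℕ) : ℕ :=
  if p % 9 = 4 ∨ p % 9 = 7 then 9 ^ n - 1
  else if p % 9 = 1 then 27 ^ n - 1
  else 0

/-- The multiplicative function `f_n`, supported on squarefree integers, with
`f_n(p) = w_n(p)` on primes: `f_n(m) = ∏_{p ∣ m} w_n(p)` for squarefree `m` and
`f_n(m) = 0` otherwise (so `f_n(1) = 1`). -/
def fn (n m : ℕ) : ℕ :=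
  if Squarefree m then ∏ p ∈ m.primeFactors, wn n p else 0

/-- The number of tuples in `𝒢_{n,bad}` (Definition 3.1 of the paper) with total
product at most `X`: tuples `(v_g)_{g ∈ G_n − {1}}` of positive squarefree pairwise
coprime integers such that `p ∣ v_g` with `π₀(q_n(g)) = 0` implies
`p ≡ 1 (mod ord g)`, and `∏_{π₀(q_n(g)) ≠ 0} v_g = 3`. -/
noncomputable def badCount (n : ℕ) (X : ℝ) : ℕ :=
  Nat.card {v : {g : Gn n // g ≠ 1} → ℕ //
    (∀ g, 0 < v g ∧ Squarefree (v g)) ∧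
    (∀ g h : {g : Gn n // g ≠ 1}, g ≠ h → Nat.Coprime (v g) (v h)) ∧
    (∀ g : {g : Gn n // g ≠ 1}, pi0 (Gn.qn g.1) = 0 →
      ∀ p, p.Prime → p ∣ v g → p ≡ 1 [MOD orderOf g.1]) ∧
    (∏ g ∈ Finset.univ.filter
        (fun g : {g : Gn n // g ≠ 1} => pi0 (Gn.qn g.1) ≠ 0), v g) = 3 ∧
    ((∏ g, v g : ℕ) : ℝ) ≤ X}

section
open Filter Topology

/-- Abel inequality. -/
lemma abel_ineq (w : ℕ → ℝ) (z : ℕ → ℂ) (η : ℝ) (hw : Antitone w) (hw0 : ∀ i, 0 ≤ w i)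
    (hz : ∀ N, ‖∑ i ∈ Finset.range N, z i‖ ≤ η) (N : ℕ) :
    ‖∑ i ∈ Finset.range N, (w i : ℂ) * z i‖ ≤ η * w 0 := by
  have hη : 0 ≤ η := (norm_nonneg _).trans (hz 0)
  rcases N.eq_zero_or_pos with rfl | hN
  · simpa using mul_nonneg hη (hw0 0)
  have h := Finset.sum_range_by_parts (fun i => (w i : ℂ)) z N
  simp only [smul_eq_mul] at h
  rw [h]
  have h2 : ‖∑ i ∈ Finset.range (N - 1), ((w (i+1) : ℂ) - w i) * ∑ j ∈ Finset.range (i+1), z j‖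
      ≤ ∑ i ∈ Finset.range (N - 1), (w i - w (i+1)) * η := by
    refine norm_sum_le_of_le _ fun i _ => ?_
    rw [norm_mul]
    have : ‖(w (i+1) : ℂ) - w i‖ = w i - w (i+1) := by
      rw [← Complex.ofReal_sub, Complex.norm_real, Real.norm_eq_abs, abs_sub_comm,
        abs_of_nonneg (sub_nonneg.2 (hw (Nat.le_succ i)))]
    rw [this]
    exact mul_le_mul_of_nonneg_left (hz _) (sub_nonneg.2 (hw (Nat.le_succ i)))
  have h3 : ‖(w (N-1) : ℂ) * ∑ i ∈ Finset.range N, z i‖ ≤ w (N-1) * η := by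
    rw [norm_mul, Complex.norm_real, Real.norm_eq_abs, abs_of_nonneg (hw0 _)]
    exact mul_le_mul_of_nonneg_left (hz _) (hw0 _)
  rw [← Finset.sum_mul, Finset.sum_range_sub'] at h2
  calc _ ≤ _ := norm_sub_le _ _
    _ ≤ w (N-1) * η + (w 0 - w (N-1)) * η := add_le_add h3 h2
    _ = _ := by ring

/-- Abel limit theorem for Dirichlet series (partial sums over `range`, index shifted by one). -/
lemma abel_dirichlet (c : ℕ → ℂ) (l : ℂ) (F : ℝ → ℂ)
    (hc : Tendsto (fun N => ∑ n ∈ Finset.range N, c n) atTop (𝓝 l))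
    (hF : ∀ ε : ℝ, 0 < ε → Tendsto (fun N => ∑ n ∈ Finset.range N,
      (((n + 1 : ℝ) ^ (-ε) : ℝ) : ℂ) * c n) atTop (𝓝 (F ε))) :
    Tendsto F (𝓝[>] 0) (𝓝 l) := by
  rw [Metric.tendsto_nhds]
  intro η hη
  have hη4 : 0 < η / 4 := by positivity
  obtain ⟨M, hM⟩ := Metric.cauchySeq_iff'.1 hc.cauchySeq (η/4) hη4
  -- tail bound
  have tail : ∀ ε : ℝ, 0 < ε → ∀ N, M ≤ N →
      ‖∑ n ∈ Finset.range N, (((n + 1 : ℝ) ^ (-ε) : ℝ) : ℂ) * c n -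
        ∑ n ∈ Finset.range M, (((n + 1 : ℝ) ^ (-ε) : ℝ) : ℂ) * c n‖ ≤ η / 4 := by
    intro ε hε N hN
    rw [← Finset.sum_Ico_eq_sub _ hN, Finset.sum_Ico_eq_sum_range]
    have hanti : ∀ i j : ℕ, i ≤ j → ((j:ℝ) + 1) ^ (-ε) ≤ ((i:ℝ)+1) ^ (-ε) := by
      intro i j hij
      apply Real.rpow_le_rpow_of_nonpos (by positivity) _ (by linarith)
      have : (i:ℝ) ≤ j := by exact_mod_cast hij
      linarith
    have := abel_ineq (fun i => (((M + i : ℕ) : ℝ) + 1) ^ (-ε)) (fun i => c (M + i)) (η/4)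
      (fun i j hij => hanti _ _ (by omega)) (fun i => by positivity) ?_ (N - M)
    · refine this.trans ?_
      have h1 : (((M + 0 : ℕ) : ℝ) + 1) ^ (-ε) ≤ 1 :=
        Real.rpow_le_one_of_one_le_of_nonpos (by simp) (by linarith)
      nlinarith
    · intro K
      have := hM (M + K) (by omega)
      rw [dist_eq_norm, ← Finset.sum_Ico_eq_sub _ (by omega), Finset.sum_Ico_eq_sum_range] at this
      simpa using this.le
  have tail2 : ∀ ε : ℝ, 0 < ε → ‖F ε -
        ∑ n ∈ Finset.range M, (((n + 1 : ℝ) ^ (-ε) : ℝ) : ℂ) * c n‖ ≤ η / 4 := by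
    intro ε hε
    refine le_of_tendsto ((hF ε hε).sub_const _).norm ?_
    filter_upwards [eventually_ge_atTop M] with N hN using tail ε hε N hN
  have tail3 : ‖l - ∑ n ∈ Finset.range M, c n‖ ≤ η / 4 := by
    refine le_of_tendsto (hc.sub_const _).norm ?_
    filter_upwards [eventually_ge_atTop M] with N hN
    have := hM N hN
    rw [dist_eq_norm] at this
    exact this.le
  have cont : Tendsto (fun ε : ℝ => ∑ n ∈ Finset.range M, (((n + 1 : ℝ) ^ (-ε) : ℝ) : ℂ) * c n)
      (𝓝[>] 0) (𝓝 (∑ n ∈ Finset.range M, c n)) := by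
    refine tendsto_nhdsWithin_of_tendsto_nhds ?_
    refine tendsto_finsetSum _ fun n _ => ?_
    have : Continuous fun ε : ℝ => (((n + 1 : ℝ) ^ (-ε) : ℝ) : ℂ) * c n := by
      refine Continuous.mul ?_ continuous_const
      refine Complex.continuous_ofReal.comp ?_
      exact Real.continuous_const_rpow (by positivity) |>.comp continuous_neg
    simpa using this.tendsto 0
  filter_upwards [Metric.tendsto_nhds.1 cont (η/4) hη4, self_mem_nhdsWithin] with ε h1 h2
  have h3 := tail2 ε h2
  rw [dist_eq_norm] at h1 ⊢
  set S := ∑ n ∈ Finset.range M, (((n + 1 : ℝ) ^ (-ε) : ℝ) : ℂ) * c n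
  set C := ∑ n ∈ Finset.range M, c n
  have : F ε - l = (F ε - S) + (S - C) - (l - C) := by ring
  rw [this]
  calc _ ≤ ‖F ε - S‖ + ‖S - C‖ + ‖l - C‖ := (norm_sub_le _ _).trans (by gcongr; exact norm_add_le _ _)
    _ < η := by linarith

lemma pow_diff_bounds (k : ℕ) (u v : ℝ) (hv : 0 ≤ v) (huv : v ≤ u) :
    u ^ (k+1) - v ^ (k+1) ≤ (k+1) * u ^ k * (u - v) ∧
    (k+1) * v ^ k * (u - v) ≤ u ^ (k+1) - v ^ (k+1) := by
  have hu : 0 ≤ u := hv.trans huv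
  induction k with
  | zero => constructor <;> simp
  | succ k ih =>
    obtain ⟨h1, h2⟩ := ih
    have hp : v ^ (k+1) ≤ u ^ (k+1) := pow_le_pow_left₀ hv huv _
    have hp1 : 0 ≤ v ^ (k+1) := by positivity
    push_cast
    constructor
    · have e1 : u ^ (k+1+1) - v^(k+1+1) = u * (u^(k+1) - v^(k+1)) + v^(k+1) * (u - v) := by ring
      have e2 := mul_le_mul_of_nonneg_left h1 hu
      have e3 : v^(k+1) * (u-v) ≤ u^(k+1) * (u - v) :=
        mul_le_mul_of_nonneg_right hp (by linarith)
      have e4 : u * ((k+1) * u^k * (u-v)) = (k+1) * u^(k+1) * (u-v) := by ring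
      rw [e1]; nlinarith
    · have e1 : u ^ (k+1+1) - v^(k+1+1) = v * (u^(k+1) - v^(k+1)) + u^(k+1) * (u - v) := by ring
      have e2 := mul_le_mul_of_nonneg_left h2 hv
      have e3 : v^(k+1) * (u-v) ≤ u^(k+1) * (u - v) :=
        mul_le_mul_of_nonneg_right hp (by linarith)
      have e4 : v * ((k+1) * v^k * (u-v)) = (k+1) * v^(k+1) * (u-v) := by ring
      rw [e1]; nlinarith

lemma log_step (x : ℝ) (e : ℕ) (he : 1 ≤ e) (hex : ((e + 1 : ℕ) : ℝ) ≤ x) (k : ℕ) :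
    Real.log (x/e) ^ (k+1) / (k+1) - Real.log (x/(e+1:ℕ)) ^ (k+1) / (k+1) ≤ 
      Real.log (x/e) ^ k / e ∧
    Real.log (x/(e+1:ℕ)) ^ k / (e+1:ℕ) ≤ 
    Real.log (x/e) ^ (k+1) / (k+1) - Real.log (x/(e+1:ℕ)) ^ (k+1) / (k+1) := by
  have he0 : (0:ℝ) < e := by exact_mod_cast he
  have he1 : (0:ℝ) < (e+1:ℕ) := by positivity
  have hx : 0 < x := he1.trans_le hex
  have hv : 0 ≤ Real.log (x/(e+1:ℕ)) := Real.log_nonneg (by rwa [le_div_iff₀ he1, one_mul])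
  have hd : Real.log (x/e) - Real.log (x/(e+1:ℕ)) = Real.log ((e+1:ℕ)/e) := by
    rw [Real.log_div hx.ne' he0.ne', Real.log_div hx.ne' he1.ne', Real.log_div he1.ne' he0.ne']
    ring
  have hd1 : Real.log (x/e) - Real.log (x/(e+1:ℕ)) ≤ 1 / e := by
    rw [hd]
    refine (Real.log_le_sub_one_of_pos (by positivity)).trans_eq ?_
    push_cast; field_simp; ring
  have hd2 : 1 / ((e+1:ℕ):ℝ) ≤ Real.log (x/e) - Real.log (x/(e+1:ℕ)) := by
    rw [hd]
    refine le_trans (le_of_eq ?_) (Real.one_sub_inv_le_log_of_pos (by positivity))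
    push_cast; field_simp; ring
  have huv : Real.log (x/(e+1:ℕ)) ≤ Real.log (x/e) := by
    have : 0 ≤ 1 / ((e+1:ℕ):ℝ) := by positivity
    linarith
  obtain ⟨h1, h2⟩ := pow_diff_bounds k _ _ hv huv
  have hu := hv.trans huv
  have hk : (0:ℝ) < k + 1 := by positivity
  set u := Real.log (x/e)
  set v := Real.log (x/(e+1:ℕ))
  rw [← sub_div]
  constructor
  · rw [div_le_iff₀ hk]
    refine h1.trans ?_
    have := mul_le_mul_of_nonneg_left hd1 (show 0 ≤ (k+1) * u^k by positivity)
    refine this.trans_eq (by ring)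
  · rw [le_div_iff₀ hk]
    refine le_trans ?_ h2
    have := mul_le_mul_of_nonneg_left hd2 (show 0 ≤ (k+1) * v^k by positivity)
    refine le_trans (le_of_eq (by ring)) this

lemma sum_log_bounds (x : ℝ) (k : ℕ) (M : ℕ) (hM : 1 ≤ M) (hMx : (M:ℝ) ≤ x) :
    Real.log x ^ (k+1) / (k+1) - Real.log (x/M) ^ (k+1) / (k+1) + Real.log (x/M) ^ k / M
      ≤ ∑ e ∈ Finset.Ioc 0 M, Real.log (x/e) ^ k / e ∧
    ∑ e ∈ Finset.Ioc 0 M, Real.log (x/e) ^ k / e ≤ Real.log x ^ k +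
      Real.log x ^ (k+1) / (k+1) - Real.log (x/M) ^ (k+1) / (k+1) := by
  induction M, hM using Nat.le_induction with
  | base => simp
  | succ M hM ih =>
    have hMx' : (M:ℝ) ≤ x := le_trans (by push_cast; linarith) hMx
    obtain ⟨h1, h2⟩ := ih hMx'
    obtain ⟨h3, h4⟩ := log_step x M hM hMx k
    rw [Finset.sum_Ioc_succ_top (by omega)]
    constructor <;> linarith

lemma sum_log_asymp (x : ℝ) (hx : 1 ≤ x) (k : ℕ) :
    |∑ e ∈ Finset.Ioc 0 ⌊x⌋₊, Real.log (x/e) ^ k / e - Real.log x ^ (k+1) / (k+1)|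
      ≤ Real.log x ^ k := by
  have hM : 1 ≤ ⌊x⌋₊ := Nat.one_le_floor_iff _ |>.2 hx
  have hMx : (⌊x⌋₊:ℝ) ≤ x := Nat.floor_le (by linarith)
  have hMx2 : x < ⌊x⌋₊ + 1 := Nat.lt_floor_add_one x
  obtain ⟨h1, h2⟩ := sum_log_bounds x k _ hM hMx
  set M := ⌊x⌋₊
  have hM0 : (0:ℝ) < M := by exact_mod_cast hM
  have hl : 0 ≤ Real.log (x/M) := Real.log_nonneg (by rwa [le_div_iff₀ hM0, one_mul])
  have hl2 : Real.log (x/M) ≤ 1 / M := by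
    refine (Real.log_le_sub_one_of_pos (by positivity)).trans ?_
    rw [div_sub_one hM0.ne']
    gcongr; linarith
  have h3 : Real.log (x/M) ^ (k+1) / (k+1) ≤ Real.log (x/M) ^ k / M := by
    have a1 : Real.log (x/M) ^ (k+1) / (k+1) ≤ Real.log (x/M) ^ (k+1) :=
      div_le_self (by positivity) (by linarith [(Nat.cast_nonneg k : (0:ℝ) ≤ k)])
    have a2 : Real.log (x/M) ^ (k+1) ≤ Real.log (x/M) ^ k * (1/M) := by
      rw [pow_succ]; gcongr
    linarith [a1.trans a2, mul_one_div (Real.log (x/M) ^ k) (M:ℝ)]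
  have h4 : 0 ≤ Real.log (x/M) ^ (k+1) / (k+1) := by positivity
  have h5 : 0 ≤ Real.log x ^ k := pow_nonneg (Real.log_nonneg hx) _
  rw [abs_le]; constructor <;> linarith

end

section
open Filter Topology

/-- `A(⌊x⌋) = c x (log x)^k + o(x (log x)^k)`, in explicit form. -/
def Asym (A : ℕ → ℂ) (c : ℂ) (k : ℕ) : Prop :=
  ∀ η : ℝ, 0 < η → ∃ K : ℝ, 0 ≤ K ∧ ∀ x : ℝ, 1 ≤ x →
    ‖A ⌊x⌋₊ - c * (x * Real.log x ^ k : ℝ)‖ ≤ η * (x * Real.log x ^ k) + K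

lemma absorb (k : ℕ) (K η : ℝ) (hK : 0 ≤ K) (hη : 0 < η) : ∃ K' : ℝ, 0 ≤ K' ∧ ∀ x : ℝ, 1 ≤ x →
    K * (x * Real.log x ^ k) ≤ η * (x * Real.log x ^ (k+1)) + K' := by
  refine ⟨K * (Real.exp (K/η) * (K/η)^k), by positivity, fun x hx => ?_⟩
  have hl := Real.log_nonneg hx
  have hx0 : 0 < x := by linarith
  by_cases h : K / η ≤ Real.log x
  · have h1 : K ≤ η * Real.log x := by rwa [div_le_iff₀' hη] at h
    have h2 := mul_le_mul_of_nonneg_right h1 (show 0 ≤ x * Real.log x ^ k by positivity)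
    have h3 : 0 ≤ K * (Real.exp (K/η) * (K/η)^k) := by positivity
    have h4 : η * Real.log x * (x * Real.log x ^ k) = η * (x * Real.log x ^ (k+1)) := by ring
    linarith
  · push Not at h
    have h1 : x ≤ Real.exp (K/η) := by
      rw [← Real.exp_log hx0]; exact Real.exp_le_exp.2 h.le
    have h2 : x * Real.log x ^ k ≤ Real.exp (K/η) * (K/η)^k := by gcongr
    have h3 := mul_le_mul_of_nonneg_left h2 hK
    have : 0 ≤ η * (x * Real.log x ^ (k+1)) := by positivity
    linarith

lemma Asym.step {A : ℕ → ℂ} {c : ℂ} {k : ℕ} (h : Asym A c k) :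
    Asym (fun N => ∑ e ∈ Finset.Ioc 0 N, A (N / e)) (c / (k+1)) (k+1) := by
  intro η hη
  obtain ⟨K, hK, hA⟩ := h (η/4) (by positivity)
  obtain ⟨K1, hK1, h1⟩ := absorb k (η/4) (η/4) (by positivity) (by positivity)
  obtain ⟨K2, hK2, h2⟩ := absorb k ‖c‖ (η/4) (by positivity) (by positivity)
  obtain ⟨K3, hK3, h3⟩ : ∃ K' : ℝ, 0 ≤ K' ∧ ∀ x : ℝ, 1 ≤ x →
      K * x ≤ η/4 * (x * Real.log x ^ (k+1)) + K' := by
    refine ⟨K * Real.exp ((1 + 4*K/η)), by positivity, fun x hx => ?_⟩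
    have hl := Real.log_nonneg hx
    have hx0 : 0 < x := by linarith
    by_cases h : 1 + 4*K/η ≤ Real.log x
    · have hq : 0 ≤ 4*K/η := by positivity
      have h1 : (1:ℝ) ≤ Real.log x := by linarith
      have h2 : Real.log x ≤ Real.log x ^ (k+1) := le_self_pow₀ h1 (by omega)
      have h3 : 4*K/η ≤ Real.log x ^ (k+1) := by linarith
      rw [div_le_iff₀ hη] at h3
      have : K * x ≤ η/4 * (x * Real.log x ^ (k+1)) := by nlinarith
      have : 0 ≤ K * Real.exp ((1 + 4*K/η)) := by positivity
      linarith
    · push Not at h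
      have h1 : x ≤ Real.exp (1 + 4*K/η) := by
        rw [← Real.exp_log hx0]; exact Real.exp_le_exp.2 h.le
      have := mul_le_mul_of_nonneg_left h1 hK
      have : 0 ≤ η/4 * (x * Real.log x ^ (k+1)) := by positivity
      linarith
  refine ⟨K1 + K2 + K3, by positivity, fun x hx => ?_⟩
  have hx0 : 0 < x := by linarith
  have hl := Real.log_nonneg hx
  set M := ⌊x⌋₊ with hM
  have hMx : (M:ℝ) ≤ x := Nat.floor_le (by linarith)
  have hS := sum_log_asymp x hx k
  rw [← hM] at hS
  set S := ∑ e ∈ Finset.Ioc 0 M, Real.log (x/e) ^ k / e with hSdef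
  have hxS : x * S = ∑ e ∈ Finset.Ioc 0 M, (x/e) * Real.log (x/e) ^ k := by
    rw [hSdef, Finset.mul_sum]
    exact Finset.sum_congr rfl fun e _ => by ring
  have e1 : ‖∑ e ∈ Finset.Ioc 0 M, A (M / e) - c * (x * S : ℝ)‖ ≤ η/4 * (x * S) + K * x := by
    rw [hxS, Complex.ofReal_sum, Finset.mul_sum, ← Finset.sum_sub_distrib]
    calc _ ≤ ∑ e ∈ Finset.Ioc 0 M, (η/4 * ((x/e) * Real.log (x/e)^k) + K) := by
          refine norm_sum_le_of_le _ fun e he => ?_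
          rw [Finset.mem_Ioc] at he
          have he0 : (0:ℝ) < e := by exact_mod_cast he.1
          have heM : (e:ℝ) ≤ M := by exact_mod_cast he.2
          have := hA (x/e) (by rw [le_div_iff₀ he0]; linarith)
          rwa [Nat.floor_div_natCast] at this
      _ ≤ _ := by
          rw [Finset.sum_add_distrib, ← Finset.mul_sum]
          simp only [Finset.sum_const, Nat.card_Ioc, nsmul_eq_mul, tsub_zero]
          have := mul_le_mul_of_nonneg_left hMx hK
          linarith
  have e2 : ‖c * (x * S : ℝ) - c/(k+1) * (x * Real.log x ^ (k+1) : ℝ)‖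
      ≤ ‖c‖ * (x * Real.log x ^ k) := by
    have : c * (x * S : ℝ) - c/(k+1) * (x * Real.log x ^ (k+1) : ℝ)
        = c * ((x * (S - Real.log x ^ (k+1) / (k+1)) : ℝ) : ℂ) := by
      push_cast; ring
    rw [this, norm_mul, Complex.norm_real, Real.norm_eq_abs, abs_mul, abs_of_pos hx0]
    gcongr
  have e3 : η/4 * (x * S) ≤ η/4 * (x * Real.log x ^ (k+1)) + η/4 * (x * Real.log x ^ k) := by
    rw [abs_le] at hS
    have : Real.log x ^ (k+1) / (k+1) ≤ Real.log x ^ (k+1) :=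
      div_le_self (by positivity) (by linarith [(Nat.cast_nonneg k : (0:ℝ) ≤ k)])
    have h5 : S ≤ Real.log x ^ (k+1) + Real.log x ^ k := by linarith [hS.2]
    have := mul_le_mul_of_nonneg_left h5 (show 0 ≤ η/4 * x by positivity)
    linarith
  have e4 := norm_sub_le_norm_sub_add_norm_sub (∑ e ∈ Finset.Ioc 0 M, A (M / e)) (c * (x * S : ℝ))
    (c/(k+1) * (x * Real.log x ^ (k+1) : ℝ))
  have := h1 x hx
  have := h2 x hx
  have := h3 x hx
  linarith

lemma Asym.of_tendsto {A : ℕ → ℂ} {c : ℂ}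
    (h : Tendsto (fun N : ℕ => A N / N) atTop (𝓝 c)) : Asym A c 0 := by
  intro η hη
  rw [Metric.tendsto_atTop] at h
  obtain ⟨N0, hN0⟩ := h η hη
  refine ⟨(∑ i ∈ Finset.range (N0+1), ‖A i‖) + ‖c‖ * (N0 + 1 + 1), by positivity, fun x hx => ?_⟩
  have hx0 : 0 < x := by linarith
  simp only [pow_zero, mul_one]
  set M := ⌊x⌋₊ with hM
  have hM1 : 1 ≤ M := Nat.one_le_floor_iff _ |>.2 hx
  have hMx : (M:ℝ) ≤ x := Nat.floor_le (by linarith)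
  have hMx2 : x < M + 1 := Nat.lt_floor_add_one x
  have hsum : 0 ≤ ∑ i ∈ Finset.range (N0+1), ‖A i‖ := by positivity
  have hdx : ‖c * (M:ℂ) - c * (x:ℂ)‖ ≤ ‖c‖ := by
    rw [← mul_sub, norm_mul]
    have : ‖(M:ℂ) - x‖ ≤ 1 := by
      rw [← Complex.ofReal_natCast, ← Complex.ofReal_sub, Complex.norm_real, Real.norm_eq_abs,
        abs_le]
      constructor <;> linarith
    nlinarith [norm_nonneg c]
  by_cases hN : N0 ≤ M
  · have h1 := hN0 M hN
    have hM0 : (M:ℂ) ≠ 0 := by exact_mod_cast (by omega)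
    rw [dist_eq_norm, div_sub' hM0, norm_div, Complex.norm_natCast, div_lt_iff₀ (by positivity)] at h1
    have h2 := norm_sub_le_norm_sub_add_norm_sub (A M) (c * M) (c * x)
    rw [mul_comm (M:ℂ) c] at h1
    have : 0 ≤ ‖c‖ * (N0+1) := by positivity
    nlinarith
  · have h1 : ‖A M‖ ≤ ∑ i ∈ Finset.range (N0+1), ‖A i‖ :=
      Finset.single_le_sum (f := fun i => ‖A i‖) (fun _ _ => norm_nonneg _)
        (Finset.mem_range.2 (by omega))
    have h2 : ‖c * (x:ℂ)‖ ≤ ‖c‖ * (N0 + 1 + 1) := by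
      rw [norm_mul, Complex.norm_real, Real.norm_eq_abs, abs_of_pos hx0]
      have : (M:ℝ) ≤ N0 := by exact_mod_cast (by omega)
      gcongr; linarith
    have := norm_sub_le (A M) (c * x)
    have : 0 ≤ η * x := by positivity
    linarith

lemma Asym.iterate {A : ℕ → ℕ → ℂ} {c : ℂ} (h0 : Asym (A 0) c 0)
    (hs : ∀ k N, A (k+1) N = ∑ e ∈ Finset.Ioc 0 N, A k (N / e)) (k : ℕ) :
    Asym (A k) (c / k.factorial) k := by
  induction k with
  | zero => simpa using h0
  | succ k ih =>
    have := ih.step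
    have e : A (k+1) = fun N => ∑ e ∈ Finset.Ioc 0 N, A k (N / e) := funext (hs k)
    rw [e]
    convert this using 1
    rw [Nat.factorial_succ]; push_cast
    rw [div_div, mul_comm]

lemma Asym.tendsto {A : ℕ → ℂ} {c : ℂ} {k : ℕ} (h : Asym A c k) :
    Tendsto (fun x : ℝ => A ⌊x⌋₊ / (x * Real.log x ^ k : ℝ)) atTop (𝓝 c) := by
  rw [Metric.tendsto_nhds]
  intro η hη
  obtain ⟨K, hK, hA⟩ := h (η/2) (by positivity)
  filter_upwards [eventually_ge_atTop (Real.exp 1), eventually_gt_atTop (2*K/η)] with x hx hx2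
  have hx1 : 1 ≤ x := (Real.one_le_exp zero_le_one).trans hx
  have hx0 : 0 < x := by linarith
  have hl : 1 ≤ Real.log x := by rwa [Real.le_log_iff_exp_le hx0]
  have hp : 1 ≤ Real.log x ^ k := one_le_pow₀ hl
  have hD : 0 < x * Real.log x ^ k := by positivity
  have hDx : x ≤ x * Real.log x ^ k := le_mul_of_one_le_right hx0.le hp
  have := hA x hx1
  set D := x * Real.log x ^ k
  have hDc : (D:ℂ) ≠ 0 := by exact_mod_cast hD.ne'
  rw [dist_eq_norm, div_sub' hDc, norm_div, Complex.norm_real, Real.norm_eq_abs, abs_of_pos hD,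
    div_lt_iff₀ hD, mul_comm (D:ℂ) c]
  rw [div_lt_iff₀ hη] at hx2
  nlinarith

end

section
open Filter Topology ArithmeticFunction

/-- Absolute convergence to the right of `1` and power-saving partial sums. -/
structure PS (b : ArithmeticFunction ℂ) : Prop where
  summ : ∀ σ : ℝ, 1 < σ → Summable (fun n : ℕ => ‖b n‖ * (n:ℝ) ^ (-σ))
  sav : ∃ δ : ℝ, 0 < δ ∧ δ ≤ 1 ∧ ∃ C : ℝ, 0 ≤ C ∧ ∀ N : ℕ,
    ‖∑ n ∈ Finset.Ioc 0 N, b n‖ ≤ C * (N:ℝ) ^ (1 - δ)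

lemma hyperbola (b₁ b₂ : ArithmeticFunction ℂ) (N : ℕ) :
    ∑ n ∈ Finset.Ioc 0 N, (b₁ * b₂) n =
      ∑ d ∈ Finset.Ioc 0 (Nat.sqrt N), b₁ d * ∑ e ∈ Finset.Ioc 0 (N / d), b₂ e +
      ∑ e ∈ Finset.Ioc 0 (Nat.sqrt N), b₂ e * ∑ d ∈ Finset.Ioc (Nat.sqrt N) (N / e), b₁ d := by
  set y := Nat.sqrt N with hy
  let lo : ArithmeticFunction ℂ := ⟨fun n => if n ≤ y then b₁ n else 0, by simp⟩
  let hi : ArithmeticFunction ℂ := ⟨fun n => if y < n then b₁ n else 0, by simp⟩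
  have hlo : ∀ n, lo n = if n ≤ y then b₁ n else 0 := fun _ => rfl
  have hhi : ∀ n, hi n = if y < n then b₁ n else 0 := fun _ => rfl
  have hsplit : b₁ = lo + hi := by
    ext n
    rw [ArithmeticFunction.add_apply, hlo, hhi]
    by_cases h : n ≤ y
    · simp [h, not_lt.2 h]
    · simp [h, not_le.1 h]
  have hyN : y ≤ N := Nat.sqrt_le_self N
  conv_lhs => rw [hsplit, add_mul]
  simp only [ArithmeticFunction.add_apply]
  rw [Finset.sum_add_distrib, mul_comm hi b₂, sum_Ioc_mul_eq_sum_sum, sum_Ioc_mul_eq_sum_sum]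
  congr 1
  · rw [← Finset.sum_subset (Finset.Ioc_subset_Ioc_right hyN)]
    · refine Finset.sum_congr rfl fun d hd => ?_
      rw [hlo, if_pos (Finset.mem_Ioc.1 hd).2]
    · intro d hd1 hd2
      have hd : ¬ d ≤ y := fun h => hd2 (Finset.mem_Ioc.2 ⟨(Finset.mem_Ioc.1 hd1).1, h⟩)
      rw [hlo, if_neg hd, zero_mul]
  · have hin : ∀ M, ∑ m ∈ Finset.Ioc 0 M, hi m = ∑ d ∈ Finset.Ioc y M, b₁ d := by
      intro M
      rw [← Finset.sum_subset (Finset.Ioc_subset_Ioc_left (Nat.zero_le y) : Finset.Ioc y M ⊆ _)]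
      · refine Finset.sum_congr rfl fun d hd => ?_
        rw [hhi, if_pos (Finset.mem_Ioc.1 hd).1]
      · intro d hd1 hd2
        have hd : ¬ y < d := fun h => hd2 (Finset.mem_Ioc.2 ⟨h, (Finset.mem_Ioc.1 hd1).2⟩)
        rw [hhi, if_neg hd]
    simp only [hin]
    rw [← Finset.sum_subset (Finset.Ioc_subset_Ioc_right hyN)]
    intro e he he2
    have he' : y < e := by
      by_contra h
      exact he2 (Finset.mem_Ioc.2 ⟨(Finset.mem_Ioc.1 he).1, not_lt.1 h⟩)
    have : N / e ≤ y := by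
      rw [Nat.div_le_iff_le_mul_add_pred (by omega)]
      have h1 : N ≤ y * y + y + y := Nat.sqrt_le_add N
      have h2 : (y + 1) * y ≤ e * y := Nat.mul_le_mul_right _ he'
      have h3 : (y + 1) * y = y * y + y := by ring
      omega
    rw [Finset.Ioc_eq_empty (by omega)]
    simp

lemma sum_abs_bound (b : ArithmeticFunction ℂ) (δ : ℝ) (hδ : 0 < δ) (hδ1 : δ ≤ 1)
    (hb : Summable (fun n : ℕ => ‖b n‖ * (n:ℝ) ^ (-(1 + δ/2)))) (N : ℕ) :
    ∑ d ∈ Finset.Ioc 0 (Nat.sqrt N), ‖b d‖ * ((N / d : ℕ) : ℝ) ^ (1 - δ) ≤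
      (∑' n : ℕ, ‖b n‖ * (n:ℝ) ^ (-(1 + δ/2))) * (N:ℝ) ^ (1 - δ/4) := by
  rcases Nat.eq_zero_or_pos N with rfl | hN
  · simp only [Nat.sqrt_zero, Finset.Ioc_self, Finset.sum_empty]
    have : 0 ≤ ∑' n : ℕ, ‖b n‖ * (n:ℝ) ^ (-(1 + δ/2)) := tsum_nonneg fun n => by positivity
    positivity
  have hN0 : (0:ℝ) < N := by exact_mod_cast hN
  have key : ∀ d ∈ Finset.Ioc 0 (Nat.sqrt N), ‖b d‖ * ((N / d : ℕ) : ℝ) ^ (1 - δ) ≤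
      ‖b d‖ * (d:ℝ) ^ (-(1 + δ/2)) * (N:ℝ) ^ (1 - δ/4) := by
    intro d hd
    rw [Finset.mem_Ioc] at hd
    have hd0 : (0:ℝ) < d := by exact_mod_cast hd.1
    have hdN : (d:ℝ) ≤ (N:ℝ) ^ (1/2 : ℝ) := by
      rw [← Real.sqrt_eq_rpow]
      apply Real.le_sqrt_of_sq_le
      have := Nat.le_sqrt.1 hd.2
      rw [sq]; exact_mod_cast this
    rw [mul_assoc]
    gcongr
    calc ((N / d : ℕ) : ℝ) ^ (1 - δ) ≤ ((N:ℝ) / d) ^ (1 - δ) :=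
          Real.rpow_le_rpow (by positivity) Nat.cast_div_le (by linarith)
      _ = (N:ℝ)^(1-δ) * (d:ℝ) ^ (-(1 + δ/2)) * (d:ℝ) ^ (3*δ/2) := by
          rw [Real.div_rpow hN0.le hd0.le, mul_assoc, ← Real.rpow_add hd0, div_eq_mul_inv,
            ← Real.rpow_neg hd0.le]
          congr 2; ring
      _ ≤ (N:ℝ)^(1-δ) * (d:ℝ) ^ (-(1 + δ/2)) * ((N:ℝ) ^ (1/2 : ℝ)) ^ (3*δ/2) := by
          gcongr
      _ = _ := by
          rw [← Real.rpow_mul hN0.le, mul_comm ((N:ℝ)^(1-δ)), mul_assoc, ← Real.rpow_add hN0]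
          congr 2; ring
  refine (Finset.sum_le_sum key).trans ?_
  rw [← Finset.sum_mul]
  gcongr
  exact hb.sum_le_tsum _ fun n _ => by positivity

lemma Ioc_bound (b : ArithmeticFunction ℂ) (δ C : ℝ) (hδ1 : δ ≤ 1) (hC : 0 ≤ C)
    (h : ∀ N : ℕ, ‖∑ n ∈ Finset.Ioc 0 N, b n‖ ≤ C * (N:ℝ) ^ (1 - δ)) (y M : ℕ) :
    ‖∑ d ∈ Finset.Ioc y M, b d‖ ≤ 2 * C * (M:ℝ) ^ (1 - δ) := by
  by_cases hyM : y ≤ M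
  · have e : ∑ d ∈ Finset.Ioc y M, b d = ∑ d ∈ Finset.Ioc 0 M, b d - ∑ d ∈ Finset.Ioc 0 y, b d := by
      rw [← Finset.sum_Ioc_consecutive _ (Nat.zero_le y) hyM]; ring
    rw [e]
    have h1 : C * (y:ℝ) ^ (1-δ) ≤ C * (M:ℝ)^(1-δ) := by
      have : (y:ℝ) ≤ M := by exact_mod_cast hyM
      gcongr
    linarith [norm_sub_le (∑ d ∈ Finset.Ioc 0 M, b d) (∑ d ∈ Finset.Ioc 0 y, b d), h M, h y]
  · rw [Finset.Ioc_eq_empty (by omega)]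
    simp; positivity

lemma weaken_sav (b : ArithmeticFunction ℂ) (δ δ' C : ℝ) (hδ : δ' ≤ δ) (hC : 0 ≤ C)
    (h : ∀ N : ℕ, ‖∑ n ∈ Finset.Ioc 0 N, b n‖ ≤ C * (N:ℝ) ^ (1 - δ)) (N : ℕ) :
    ‖∑ n ∈ Finset.Ioc 0 N, b n‖ ≤ C * (N:ℝ) ^ (1 - δ') := by
  rcases Nat.eq_zero_or_pos N with rfl | hN
  · simp; positivity
  refine (h N).trans ?_
  have : (1:ℝ) ≤ N := by exact_mod_cast hN
  gcongr

lemma LSeriesSummable_iff' (b : ArithmeticFunction ℂ) (σ : ℝ) :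
    LSeriesSummable (fun n => b n) (σ:ℂ) ↔ Summable (fun n : ℕ => ‖b n‖ * (n:ℝ) ^ (-σ)) := by
  unfold LSeriesSummable
  rw [← summable_norm_iff]
  refine summable_congr fun n => ?_
  rw [LSeries.norm_term_eq]
  rcases Nat.eq_zero_or_pos n with rfl | hn
  · simp
  · rw [if_neg hn.ne', Complex.ofReal_re, Real.rpow_neg (by positivity), div_eq_mul_inv]

lemma PS.mul {b₁ b₂ : ArithmeticFunction ℂ} (h₁ : PS b₁) (h₂ : PS b₂) : PS (b₁ * b₂) := by
  refine ⟨fun σ hσ => ?_, ?_⟩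
  · rw [← LSeriesSummable_iff']
    exact ArithmeticFunction.LSeriesSummable_mul ((LSeriesSummable_iff' _ _).2 (h₁.summ σ hσ))
      ((LSeriesSummable_iff' _ _).2 (h₂.summ σ hσ))
  · obtain ⟨δ₁, hδ₁, hδ₁', C₁, hC₁, H₁⟩ := h₁.sav
    obtain ⟨δ₂, hδ₂, hδ₂', C₂, hC₂, H₂⟩ := h₂.sav
    set δ := min δ₁ δ₂ with hδdef
    have hδ : 0 < δ := lt_min hδ₁ hδ₂
    have hδ1 : δ ≤ 1 := (min_le_left _ _).trans hδ₁'
    replace H₁ := weaken_sav b₁ δ₁ δ C₁ (min_le_left _ _) hC₁ H₁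
    replace H₂ := weaken_sav b₂ δ₂ δ C₂ (min_le_right _ _) hC₂ H₂
    have s₁ := h₁.summ (1 + δ/2) (by linarith)
    have s₂ := h₂.summ (1 + δ/2) (by linarith)
    set K₁ := ∑' n : ℕ, ‖b₁ n‖ * (n:ℝ) ^ (-(1 + δ/2))
    set K₂ := ∑' n : ℕ, ‖b₂ n‖ * (n:ℝ) ^ (-(1 + δ/2))
    have hK₁ : 0 ≤ K₁ := tsum_nonneg fun n => by positivity
    have hK₂ : 0 ≤ K₂ := tsum_nonneg fun n => by positivity
    refine ⟨δ/4, by linarith, by linarith, C₂ * K₁ + 2 * C₁ * K₂, by positivity, fun N => ?_⟩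
    rw [hyperbola]
    refine (norm_add_le _ _).trans ?_
    rw [add_mul]
    have a1 := sum_abs_bound b₁ δ hδ hδ1 s₁ N
    have a2 := sum_abs_bound b₂ δ hδ hδ1 s₂ N
    refine add_le_add ?_ ?_
    · calc _ ≤ ∑ d ∈ Finset.Ioc 0 (Nat.sqrt N), C₂ * (‖b₁ d‖ * ((N / d : ℕ) : ℝ) ^ (1 - δ)) := by
            refine norm_sum_le_of_le _ fun d _ => ?_
            rw [norm_mul]
            have := mul_le_mul_of_nonneg_left (H₂ (N / d)) (norm_nonneg (b₁ d))
            linarith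
        _ ≤ _ := by
            rw [← Finset.mul_sum, mul_assoc]
            exact mul_le_mul_of_nonneg_left a1 hC₂
    · calc _ ≤ ∑ d ∈ Finset.Ioc 0 (Nat.sqrt N), 2 * C₁ * (‖b₂ d‖ * ((N / d : ℕ) : ℝ) ^ (1 - δ)) := by
            refine norm_sum_le_of_le _ fun d _ => ?_
            rw [norm_mul]
            have := mul_le_mul_of_nonneg_left (Ioc_bound b₁ δ C₁ hδ1 hC₁ H₁ (Nat.sqrt N) (N / d))
              (norm_nonneg (b₂ d))
            linarith
        _ ≤ _ := by
            rw [← Finset.mul_sum, mul_assoc (2 * C₁) K₂]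
            exact mul_le_mul_of_nonneg_left a2 (by positivity)

lemma PS.one : PS 1 := by
  have hz : ∀ n : ℕ, n ≠ 1 → (1 : ArithmeticFunction ℂ) n = 0 := fun n hn => by
    simp [ArithmeticFunction.one_apply, hn]
  refine ⟨fun σ _ => summable_of_ne_finset_zero (s := {1}) fun n hn => ?_, 1, one_pos, le_rfl, 1,
    zero_le_one, fun N => ?_⟩
  · rw [hz n (by simpa using hn)]; simp
  · simp only [sub_self, Real.rpow_zero, mul_one]
    refine (norm_sum_le _ _).trans ?_
    have : ∀ n ∈ Finset.Ioc 0 N, ‖(1 : ArithmeticFunction ℂ) n‖ = if n = 1 then 1 else 0 := by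
      intro n _
      rw [ArithmeticFunction.one_apply]; split_ifs <;> simp
    rw [Finset.sum_congr rfl this, Finset.sum_ite_eq']
    split_ifs <;> simp

lemma PS.pow {b : ArithmeticFunction ℂ} (h : PS b) (k : ℕ) : PS (b ^ k) := by
  induction k with
  | zero => simpa using PS.one
  | succ k ih => rw [pow_succ]; exact ih.mul h

lemma PS.prod {ι : Type*} (s : Finset ι) (b : ι → ArithmeticFunction ℂ) (h : ∀ i ∈ s, PS (b i)) :
    PS (∏ i ∈ s, b i) := by
  classical
  induction s using Finset.induction_on with
  | empty => simpa using PS.one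
  | insert i s hi ih =>
    rw [Finset.prod_insert hi]
    exact (h i (by simp)).mul (ih fun j hj => h j (by simp [hj]))

lemma PS.converges {b : ArithmeticFunction ℂ} (h : PS b) :
    ∃ l : ℂ, Tendsto (fun N => ∑ n ∈ Finset.range N, b (n+1) / ((n:ℂ)+1)) atTop (𝓝 l) := by
  obtain ⟨δ, hδ, hδ1, C, hC, H⟩ := h.sav
  have hG : ∀ N, ∑ j ∈ Finset.range N, b (j+1) = ∑ n ∈ Finset.Ioc 0 N, b n := by
    intro N
    induction N with
    | zero => simp
    | succ N ih => rw [Finset.sum_range_succ, ih, Finset.sum_Ioc_succ_top (by omega)]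
  have hparts : ∀ N, ∑ n ∈ Finset.range (N+1), b (n+1) / ((n:ℂ)+1) =
      (1 / ((N:ℂ)+1)) * ∑ n ∈ Finset.Ioc 0 (N+1), b n + 
        ∑ i ∈ Finset.range N, (1/((i:ℂ)+1) - 1/((i:ℂ)+2)) * ∑ n ∈ Finset.Ioc 0 (i+1), b n := by
    intro N
    have := Finset.sum_range_by_parts (fun i : ℕ => 1 / ((i:ℂ)+1)) (fun i => b (i+1)) (N+1)
    simp only [smul_eq_mul, hG, Nat.add_sub_cancel] at this
    have e : ∀ n : ℕ, b (n+1) / ((n:ℂ)+1) = 1 / ((n:ℂ)+1) * b (n+1) := fun n => by ring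
    simp only [e]
    rw [this, sub_eq_add_neg, ← Finset.sum_neg_distrib]
    congr 1
    refine Finset.sum_congr rfl fun i _ => ?_
    push_cast; ring
  have hsum : Summable fun i : ℕ => (1/((i:ℂ)+1) - 1/((i:ℂ)+2)) * ∑ n ∈ Finset.Ioc 0 (i+1), b n := by
    refine Summable.of_norm_bounded (g := fun i : ℕ => C * (((i+1:ℕ):ℝ)) ^ (-(1+δ))) ?_ ?_
    · refine Summable.mul_left _ ?_
      exact (summable_nat_add_iff 1).2 (Real.summable_nat_rpow.2 (by linarith))
    · intro i
      rw [norm_mul]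
      have hi : (0:ℝ) < ((i+1:ℕ):ℝ) := by positivity
      have e1 : ‖1/((i:ℂ)+1) - 1/((i:ℂ)+2)‖ ≤ ((i+1:ℕ):ℝ) ^ (-2:ℝ) := by
        have : 1/((i:ℂ)+1) - 1/((i:ℂ)+2) = ((1/((i:ℝ)+1) - 1/((i:ℝ)+2) : ℝ) : ℂ) := by push_cast; ring
        rw [this, Complex.norm_real, Real.norm_eq_abs]
        have e2 : 1/((i:ℝ)+1) - 1/((i:ℝ)+2) = 1 / (((i:ℝ)+1) * (i+2)) := by field_simp; ring
        rw [e2, abs_of_pos (by positivity), Real.rpow_neg (by positivity), ← one_div,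
          Real.rpow_two]
        push_cast
        gcongr
        nlinarith [(Nat.cast_nonneg i : (0:ℝ) ≤ i)]
      calc _ ≤ ((i+1:ℕ):ℝ) ^ (-2:ℝ) * (C * ((i+1:ℕ):ℝ) ^ (1-δ)) := by
            gcongr; exact H _
        _ = _ := by
            rw [mul_left_comm, ← Real.rpow_add hi]; congr 2; ring
  have hz : Tendsto (fun N : ℕ => (1 / ((N:ℂ)+1)) * ∑ n ∈ Finset.Ioc 0 (N+1), b n) atTop (𝓝 0) := by
    refine squeeze_zero_norm (a := fun N : ℕ => C * ((N+1:ℕ):ℝ) ^ (-δ)) ?_ ?_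
    · intro N
      have hi : (0:ℝ) < ((N+1:ℕ):ℝ) := by positivity
      rw [norm_mul]
      have e1 : ‖1/((N:ℂ)+1)‖ = ((N+1:ℕ):ℝ) ^ (-1:ℝ) := by
        rw [norm_div, norm_one, Real.rpow_neg_one, one_div]
        congr 1
        exact_mod_cast Complex.norm_natCast (N+1)
      rw [e1]
      calc _ ≤ ((N+1:ℕ):ℝ) ^ (-1:ℝ) * (C * ((N+1:ℕ):ℝ) ^ (1-δ)) := by
            gcongr; exact H _
        _ = _ := by
            rw [mul_left_comm, ← Real.rpow_add hi]; congr 2; ring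
    · have : Tendsto (fun N : ℕ => ((N+1:ℕ):ℝ) ^ (-δ)) atTop (𝓝 0) :=
        (tendsto_rpow_neg_atTop hδ).comp
          (tendsto_natCast_atTop_atTop.comp (tendsto_add_atTop_nat 1))
      simpa using this.const_mul C
  refine ⟨0 + ∑' i : ℕ, (1/((i:ℂ)+1) - 1/((i:ℂ)+2)) * ∑ n ∈ Finset.Ioc 0 (i+1), b n,
    (tendsto_add_atTop_iff_nat 1).1 ?_⟩
  simp only [hparts]
  exact hz.add hsum.hasSum.tendsto_sum_nat

lemma PS.mean {b : ArithmeticFunction ℂ} (h : PS b) {l : ℂ}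
    (hl : Tendsto (fun N => ∑ n ∈ Finset.range N, b (n+1) / ((n:ℂ)+1)) atTop (𝓝 l)) :
    Tendsto (fun N : ℕ => (∑ n ∈ Finset.Ioc 0 N, (b * (zeta : ArithmeticFunction ℂ)) n) / N) atTop (𝓝 l) := by
  obtain ⟨δ, hδ, hδ1, C, hC, H⟩ := h.sav
  have hzs : Summable (fun n : ℕ => ‖((zeta : ArithmeticFunction ℂ)) n‖ * (n:ℝ) ^ (-(1 + δ/2))) := by
    refine Summable.of_nonneg_of_le (fun n => by positivity) (fun n => ?_)
      (Real.summable_nat_rpow.2 (show -(1+δ/2) < -1 by linarith))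
    refine mul_le_of_le_one_left (by positivity) ?_
    rw [natCoe_apply, zeta_apply]; split_ifs <;> simp
  have hbs := h.summ (3/2) (by norm_num)
  set K := ∑' n : ℕ, ‖b n‖ * (n:ℝ) ^ (-(3/2:ℝ))
  set Z := ∑' n : ℕ, ‖((zeta : ArithmeticFunction ℂ)) n‖ * (n:ℝ) ^ (-(1 + δ/2))
  have hZ : 0 ≤ Z := tsum_nonneg fun n => by positivity
  have hG : ∀ N, ∑ j ∈ Finset.range N, b (j+1) / ((j:ℂ)+1) = ∑ n ∈ Finset.Ioc 0 N, b n / n := by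
    intro N
    induction N with
    | zero => simp
    | succ N ih => rw [Finset.sum_range_succ, ih, Finset.sum_Ioc_succ_top (by omega)]; push_cast; rfl
  simp only [hG] at hl
  have hsq : Tendsto Nat.sqrt atTop atTop := by
    refine tendsto_atTop.2 fun k => ?_
    filter_upwards [eventually_ge_atTop (k*k)] with N hN using Nat.le_sqrt.2 hN
  have hl2 := hl.comp hsq
  have herr : Tendsto (fun N : ℕ => (∑ n ∈ Finset.Ioc 0 N, (b * (zeta : ArithmeticFunction ℂ)) n) / N
      - ∑ n ∈ Finset.Ioc 0 (Nat.sqrt N), b n / n) atTop (𝓝 0) := by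
    refine squeeze_zero_norm' (a := fun N : ℕ => K * (N:ℝ) ^ (-(1/4:ℝ)) + 2 * C * Z * (N:ℝ)^(-(δ/4))) ?_ ?_
    · filter_upwards [eventually_gt_atTop 0] with N hN
      have hN0 : (0:ℝ) < N := by exact_mod_cast hN
      have hNc : (N:ℂ) ≠ 0 := by exact_mod_cast hN.ne'
      rw [div_sub' hNc, norm_div, Complex.norm_natCast, div_le_iff₀ hN0, hyperbola, add_sub_right_comm]
      have e0 : (K * (N:ℝ) ^ (-(1/4:ℝ)) + 2 * C * Z * (N:ℝ)^(-(δ/4))) * N = 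
          K * (N:ℝ) ^ (3/4:ℝ) + 2 * C * Z * (N:ℝ)^(1-δ/4) := by
        have e1 : (N:ℝ) ^ (3/4:ℝ) = (N:ℝ) ^ (-(1/4:ℝ)) * N := by
          rw [← Real.rpow_add_one hN0.ne']; norm_num
        have e2 : (N:ℝ) ^ (1-δ/4:ℝ) = (N:ℝ) ^ (-(δ/4:ℝ)) * N := by
          rw [← Real.rpow_add_one hN0.ne']; congr 1; ring
        rw [e1, e2]; ring
      rw [e0]
      refine (norm_add_le _ _).trans (add_le_add ?_ ?_)
      · rw [Finset.mul_sum, ← Finset.sum_sub_distrib]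
        calc _ ≤ ∑ d ∈ Finset.Ioc 0 (Nat.sqrt N), ‖b d‖ * (d:ℝ) ^ (-(3/2:ℝ)) * (N:ℝ) ^ (3/4:ℝ) := by
              refine norm_sum_le_of_le _ fun d hd => ?_
              rw [Finset.mem_Ioc] at hd
              have hd0 : (0:ℝ) < d := by exact_mod_cast hd.1
              have hzeta : ∑ e ∈ Finset.Ioc 0 (N/d), (zeta : ArithmeticFunction ℂ) e = ((N/d:ℕ):ℂ) := by
                simp_rw [natCoe_apply]
                rw_mod_cast [sum_Ioc_zeta]
              rw [hzeta]
              have e1 : b d * ((N/d:ℕ):ℂ) - N * (b d / d) = b d * (((N/d:ℕ):ℝ) - (N:ℝ)/d : ℝ) := by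
                push_cast; ring
              rw [e1, norm_mul, mul_assoc, Complex.norm_real, Real.norm_eq_abs]
              gcongr
              have e2 : |((N/d:ℕ):ℝ) - (N:ℝ)/d| ≤ 1 := by
                have a1 : ((N/d:ℕ):ℝ) ≤ (N:ℝ)/d := Nat.cast_div_le
                have a2 : (N:ℝ)/d < (N/d:ℕ) + 1 := by
                  rw [div_lt_iff₀ hd0]
                  exact_mod_cast Nat.lt_mul_of_div_lt (Nat.lt_succ_self (N/d)) hd.1
                rw [abs_le]; constructor <;> linarith
              refine e2.trans ?_
              have hdN : (d:ℝ) ≤ (N:ℝ) ^ (1/2 : ℝ) := by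
                rw [← Real.sqrt_eq_rpow]
                apply Real.le_sqrt_of_sq_le
                have := Nat.le_sqrt.1 hd.2
                rw [sq]; exact_mod_cast this
              calc (1:ℝ) = (d:ℝ) ^ (-(3/2:ℝ)) * (d:ℝ) ^ (3/2:ℝ) := by
                    rw [← Real.rpow_add hd0]; norm_num
                _ ≤ (d:ℝ) ^ (-(3/2:ℝ)) * ((N:ℝ) ^ (1/2 : ℝ)) ^ (3/2:ℝ) := by gcongr
                _ = _ := by rw [← Real.rpow_mul hN0.le]; norm_num
          _ ≤ _ := by
              rw [← Finset.sum_mul]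
              gcongr
              exact hbs.sum_le_tsum _ fun n _ => by positivity
      · have a2 := sum_abs_bound (zeta : ArithmeticFunction ℂ) δ hδ hδ1 hzs N
        calc _ ≤ ∑ d ∈ Finset.Ioc 0 (Nat.sqrt N), 2 * C * (‖(zeta : ArithmeticFunction ℂ) d‖ * ((N / d : ℕ) : ℝ) ^ (1 - δ)) := by
              refine norm_sum_le_of_le _ fun d _ => ?_
              rw [norm_mul]
              have := mul_le_mul_of_nonneg_left (Ioc_bound b δ C hδ1 hC H (Nat.sqrt N) (N / d))
                (norm_nonneg ((zeta : ArithmeticFunction ℂ) d))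
              linarith
          _ ≤ _ := by
              rw [← Finset.mul_sum, mul_assoc (2 * C) Z]
              exact mul_le_mul_of_nonneg_left a2 (by positivity)
    · have t1 : Tendsto (fun N : ℕ => (N:ℝ) ^ (-(1/4:ℝ))) atTop (𝓝 0) :=
        (tendsto_rpow_neg_atTop (by norm_num)).comp tendsto_natCast_atTop_atTop
      have t2 : Tendsto (fun N : ℕ => (N:ℝ) ^ (-(δ/4:ℝ))) atTop (𝓝 0) :=
        (tendsto_rpow_neg_atTop (by linarith)).comp tendsto_natCast_atTop_atTop
      simpa using (t1.const_mul K).add (t2.const_mul (2*C*Z))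
  have := herr.add hl2
  simpa using this

/-- The main analytic statement. -/
lemma PS.asym {b : ArithmeticFunction ℂ} (h : PS b) {l : ℂ}
    (hl : Tendsto (fun N => ∑ n ∈ Finset.range N, b (n+1) / ((n:ℂ)+1)) atTop (𝓝 l)) (k : ℕ) :
    Tendsto (fun x : ℝ => (∑ n ∈ Finset.Ioc 0 ⌊x⌋₊, (b * (zeta : ArithmeticFunction ℂ) ^ (k+1)) n) /
      (x * Real.log x ^ k : ℝ)) atTop (𝓝 (l / k.factorial)) := by
  have h0 := Asym.of_tendsto (h.mean hl)
  refine (Asym.iterate (A := fun k N => ∑ n ∈ Finset.Ioc 0 N,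
    (b * (zeta : ArithmeticFunction ℂ) ^ (k+1)) n) (by simpa using h0) ?_ k).tendsto
  intro k N
  rw [pow_succ, ← mul_assoc, mul_comm, sum_Ioc_mul_eq_sum_sum]
  refine Finset.sum_congr rfl fun e he => ?_
  rw [Finset.mem_Ioc] at he
  rw [natCoe_apply, zeta_apply_ne (by omega), Nat.cast_one, one_mul]

end

section
open Filter Topology ArithmeticFunction
open scoped ArithmeticFunction.Moebius ArithmeticFunction.zeta

/-- A Dirichlet character mod 9 as an arithmetic function. -/
noncomputable def chiA (χ : DirichletCharacter ℂ 9) : ArithmeticFunction ℂ :=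
  ⟨fun n => χ (n : ZMod 9), by
    simp only [Nat.cast_zero]
    exact MulChar.map_nonunit χ (by decide)⟩

lemma chiA_apply (χ : DirichletCharacter ℂ 9) (n : ℕ) : chiA χ n = χ (n : ZMod 9) := rfl

lemma chiA_mul_inv (χ : DirichletCharacter ℂ 9) :
    chiA χ * (chiA χ).pmul (μ : ArithmeticFunction ℂ) = 1 := by
  ext n
  rw [ArithmeticFunction.mul_apply]
  have h1 : ∀ x ∈ n.divisorsAntidiagonal, chiA χ x.1 * (chiA χ).pmul (μ : ArithmeticFunction ℂ) x.2
      = chiA χ n * ((ζ : ArithmeticFunction ℂ) x.1 * (μ : ArithmeticFunction ℂ) x.2) := by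
    intro x hx
    rw [Nat.mem_divisorsAntidiagonal] at hx
    have hx1 : x.1 ≠ 0 := by rintro h; simp [h] at hx; omega
    rw [pmul_apply, natCoe_apply, zeta_apply_ne hx1, ← hx.1, chiA_apply, chiA_apply, chiA_apply,
      Nat.cast_mul, map_mul]
    push_cast; ring
  rw [Finset.sum_congr rfl h1, ← Finset.mul_sum, ← ArithmeticFunction.mul_apply,
    coe_zeta_mul_coe_moebius]
  by_cases hn : n = 1
  · subst hn; simp [chiA_apply]
  · rw [one_apply_ne hn, mul_zero]

lemma chiA_norm_le (χ : DirichletCharacter ℂ 9) (n : ℕ) : ‖chiA χ n‖ ≤ 1 :=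
  DirichletCharacter.norm_le_one χ _

lemma chi_period (χ : DirichletCharacter ℂ 9) (hχ : χ ≠ 1) (N : ℕ) :
    ∑ i ∈ Finset.range 9, χ ((N + i : ℕ) : ZMod 9) = 0 := by
  have h := MulChar.sum_eq_zero_of_ne_one hχ
  rw [← Fintype.sum_equiv (Equiv.addLeft (N : ZMod 9)) (fun x => χ (N + x)) _ (fun x => rfl)] at h
  rw [← h]
  have := Fin.sum_univ_eq_sum_range (fun i => χ ((N + i : ℕ) : ZMod 9)) 9
  rw [← this]
  refine Finset.sum_congr rfl fun i _ => ?_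
  congr 1
  push_cast
  congr 1
  exact ZMod.natCast_zmod_val (n := 9) i

lemma chi_range_bound (χ : DirichletCharacter ℂ 9) (hχ : χ ≠ 1) (N : ℕ) :
    ‖∑ i ∈ Finset.range N, χ (i : ZMod 9)‖ ≤ 9 := by
  induction N using Nat.strong_induction_on with
  | _ N ih =>
    by_cases h : N < 9
    · refine (norm_sum_le_of_le _ fun i _ => DirichletCharacter.norm_le_one χ _).trans ?_
      simp; exact_mod_cast h.le
    · obtain ⟨M, rfl⟩ : ∃ M, N = M + 9 := ⟨N - 9, by omega⟩
      rw [Finset.sum_range_add, chi_period χ hχ, add_zero]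
      exact ih M (by omega)

lemma chi_Ioc_bound (χ : DirichletCharacter ℂ 9) (hχ : χ ≠ 1) (N : ℕ) :
    ‖∑ i ∈ Finset.Ioc 0 N, chiA χ i‖ ≤ 9 := by
  have : ∑ i ∈ Finset.Ioc 0 N, chiA χ i = ∑ i ∈ Finset.range (N+1), χ (i : ZMod 9) := by
    induction N with
    | zero => simp [MulChar.map_nonunit χ (show ¬ IsUnit (0 : ZMod 9) by decide)]
    | succ N ih => rw [Finset.sum_range_succ, ← ih, Finset.sum_Ioc_succ_top (by omega), chiA_apply]
  rw [this]
  exact chi_range_bound χ hχ _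

lemma chiA_PS (χ : DirichletCharacter ℂ 9) (hχ : χ ≠ 1) : PS (chiA χ) := by
  refine ⟨fun σ hσ => ?_, 1, one_pos, le_rfl, 9, by norm_num, fun N => ?_⟩
  · refine Summable.of_nonneg_of_le (fun n => by positivity) (fun n => ?_)
      (Real.summable_nat_rpow.2 (show -σ < -1 by linarith))
    exact mul_le_of_le_one_left (by positivity) (chiA_norm_le χ n)
  · simpa using chi_Ioc_bound χ hχ N

lemma chiA_mult (χ : DirichletCharacter ℂ 9) : (chiA χ).IsMultiplicative := by
  refine ⟨by simp [chiA_apply], fun {m n} _ => ?_⟩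
  simp [chiA_apply]

/-- Multiplicative functions with bounded, eventually vanishing values on prime powers. -/
structure VV (f : ArithmeticFunction ℂ) : Prop where
  mult : f.IsMultiplicative
  bd : ∃ D : ℕ, ∃ K : ℝ, 0 ≤ K ∧ ∀ p : ℕ, p.Prime → ∀ k, ‖f (p^k)‖ ≤ K ∧ (D < k → f (p^k) = 0)

lemma mul_prime_pow (f g : ArithmeticFunction ℂ) {p : ℕ} (hp : p.Prime) (k : ℕ) :
    (f * g) (p^k) = ∑ i ∈ Finset.range (k+1), f (p^i) * g (p^(k-i)) := by
  rw [ArithmeticFunction.mul_apply, Nat.sum_divisorsAntidiagonal (fun a b => f a * g b),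
    Nat.sum_divisors_prime_pow hp]
  refine Finset.sum_congr rfl fun i hi => ?_
  rw [Nat.pow_div (by simp at hi; omega) hp.pos]

lemma VV.mul {f g : ArithmeticFunction ℂ} (hf : VV f) (hg : VV g) : VV (f * g) := by
  refine ⟨hf.mult.mul hg.mult, ?_⟩
  obtain ⟨D₁, K₁, hK₁, H₁⟩ := hf.bd
  obtain ⟨D₂, K₂, hK₂, H₂⟩ := hg.bd
  have hz : ∀ p : ℕ, p.Prime → ∀ k, D₁ + D₂ < k → (f*g) (p^k) = 0 := by
    intro p hp k hk
    rw [mul_prime_pow _ _ hp]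
    refine Finset.sum_eq_zero fun i hi => ?_
    by_cases h : D₁ < i
    · rw [(H₁ p hp i).2 h, zero_mul]
    · rw [(H₂ p hp (k-i)).2 (by omega), mul_zero]
  refine ⟨D₁ + D₂, (D₁ + D₂ + 1) * (K₁ * K₂), by positivity, fun p hp k => ⟨?_, hz p hp k⟩⟩
  by_cases h : D₁ + D₂ < k
  · rw [hz p hp k h, norm_zero]; positivity
  · rw [mul_prime_pow _ _ hp]
    refine (norm_sum_le_of_le (f := fun i => f (p^i) * g (p^(k-i))) (n := fun _ => K₁ * K₂) _
      fun i _ => ?_).trans ?_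
    · rw [norm_mul]
      exact mul_le_mul (H₁ p hp _).1 (H₂ p hp _).1 (norm_nonneg _) hK₁
    · rw [Finset.sum_const, Finset.card_range, nsmul_eq_mul]
      gcongr
      exact_mod_cast (by omega : k + 1 ≤ D₁ + D₂ + 1)

lemma VV.one : VV 1 := by
  refine ⟨isMultiplicative_one, 0, 1, zero_le_one, fun p hp k => ⟨?_, fun hk => ?_⟩⟩
  · rw [ArithmeticFunction.one_apply]; split_ifs <;> simp
  · exact one_apply_ne (by simp [hp.ne_one, hk.ne'])

lemma VV.pow {f : ArithmeticFunction ℂ} (hf : VV f) (k : ℕ) : VV (f^k) := by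
  induction k with
  | zero => simpa using VV.one
  | succ k ih => rw [pow_succ]; exact ih.mul hf

lemma VV.prod {ι : Type*} (s : Finset ι) (b : ι → ArithmeticFunction ℂ) (h : ∀ i ∈ s, VV (b i)) :
    VV (∏ i ∈ s, b i) := by
  classical
  induction s using Finset.induction_on with
  | empty => simpa using VV.one
  | insert i s hi ih =>
    rw [Finset.prod_insert hi]
    exact (h i (by simp)).mul (ih fun j hj => h j (by simp [hj]))

lemma mul_prime {f g : ArithmeticFunction ℂ} (hf : f 1 = 1) (hg : g 1 = 1) {p : ℕ} (hp : p.Prime) :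
    (f * g) p = f p + g p := by
  have := mul_prime_pow f g hp 1
  simp only [Finset.sum_range_succ, Finset.range_zero, Finset.sum_empty, pow_zero, pow_one, hf, hg,
    Nat.sub_self, Nat.sub_zero] at this
  rw [this]; ring

lemma pow_prime {f : ArithmeticFunction ℂ} (hf : VV f) {p : ℕ} (hp : p.Prime) (k : ℕ) :
    (f ^ k) p = k * f p := by
  induction k with
  | zero => simp [one_apply_ne hp.ne_one]
  | succ k ih => rw [pow_succ, mul_prime (hf.pow k).mult.1 hf.mult.1 hp, ih]; push_cast; ring

lemma prod_prime {ι : Type*} (s : Finset ι) (b : ι → ArithmeticFunction ℂ) (h : ∀ i ∈ s, VV (b i))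
    {p : ℕ} (hp : p.Prime) : (∏ i ∈ s, b i) p = ∑ i ∈ s, b i p := by
  classical
  induction s using Finset.induction_on with
  | empty => simp [one_apply_ne hp.ne_one]
  | insert i s hi ih =>
    rw [Finset.prod_insert hi, Finset.sum_insert hi, mul_prime (h i (by simp)).mult.1
      (VV.prod s b fun j hj => h j (by simp [hj])).mult.1 hp, ih fun j hj => h j (by simp [hj])]

lemma VV.moebius : VV (μ : ArithmeticFunction ℂ) := by
  refine ⟨isMultiplicative_moebius.intCast, 1, 1, zero_le_one, fun p hp k => ⟨?_, fun hk => ?_⟩⟩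
  · rw [intCoe_apply, Complex.norm_intCast]
    exact_mod_cast abs_moebius_le_one
  · rw [intCoe_apply, moebius_apply_prime_pow hp (by omega), if_neg (by omega), Int.cast_zero]

lemma VV.twist (χ : DirichletCharacter ℂ 9) : VV ((chiA χ).pmul (μ : ArithmeticFunction ℂ)) := by
  obtain ⟨D, K, hK, H⟩ := VV.moebius.bd
  refine ⟨(chiA_mult χ).pmul VV.moebius.mult, D, K, hK, fun p hp k => ⟨?_, fun hk => ?_⟩⟩
  · rw [pmul_apply, norm_mul]
    exact (mul_le_of_le_one_left (norm_nonneg _) (chiA_norm_le χ _)).trans (H p hp k).1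
  · rw [pmul_apply, (H p hp k).2 hk, mul_zero]

/-- Absolute convergence at `3/4`. -/
lemma VV.summable {f : ArithmeticFunction ℂ} (hf : VV f) (h0 : ∀ p : ℕ, p.Prime → p ≠ 3 → f p = 0) :
    Summable (fun n : ℕ => ‖f n‖ * (n:ℝ) ^ (-(3/4):ℝ)) := by
  obtain ⟨D, K, hK, H⟩ := hf.bd
  set u : ℕ → ℝ := fun n => ‖f n‖ * (n:ℝ) ^ (-(3/4):ℝ) with hu
  have hu0 : ∀ n, 0 ≤ u n := fun n => by positivity
  have hu1 : u 1 = 1 := by simp [hu, hf.mult.1]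
  have humul : ∀ {m n : ℕ}, Nat.Coprime m n → u (m * n) = u m * u n := by
    intro m n hmn
    simp only [hu]
    rw [hf.mult.2 hmn, norm_mul, Nat.cast_mul, Real.mul_rpow (by positivity) (by positivity)]
    ring
  have huz : ∀ p : ℕ, p.Prime → ∀ k, k ∉ Finset.range (D+2) → u (p^k) = 0 := by
    intro p hp k hk
    simp only [Finset.mem_range, not_lt] at hk
    simp only [hu]
    rw [(H p hp k).2 (by omega)]; simp
  have hsum : ∀ {p : ℕ}, p.Prime → Summable (fun k : ℕ => ‖u (p^k)‖) := by
    intro p hp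
    refine summable_of_ne_finset_zero (s := Finset.range (D+2)) fun k hk => ?_
    rw [huz p hp k hk, norm_zero]
  set t : ℕ → ℝ := fun p => D * K * (p:ℝ) ^ (-(3/2):ℝ) + if p = 3 then K else 0 with ht
  have ht0 : ∀ p, 0 ≤ t p := fun p => by
    simp only [ht]; split_ifs <;> positivity
  have hts : Summable t := by
    refine Summable.add ((Real.summable_nat_rpow.2 (by norm_num)).mul_left _) ?_
    exact summable_of_ne_finset_zero (s := {3}) fun k hk => if_neg (by simpa using hk)
  have hloc : ∀ p : ℕ, p.Prime → ∑' k, u (p^k) ≤ 1 + t p := by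
    intro p hp
    rw [tsum_eq_sum (huz p hp), Finset.sum_range_succ', Finset.sum_range_succ', pow_zero, hu1]
    have hp1 : (1:ℝ) ≤ p := by exact_mod_cast hp.one_lt.le
    have e1 : ∑ k ∈ Finset.range D, u (p^(k+1+1)) ≤ D * K * (p:ℝ) ^ (-(3/2):ℝ) := by
      refine (Finset.sum_le_sum (g := fun _ => K * (p:ℝ) ^ (-(3/2):ℝ)) fun k _ => ?_).trans ?_
      · simp only [hu]
        gcongr
        · exact (H p hp _).1
        · rw [Nat.cast_pow, ← Real.rpow_natCast, ← Real.rpow_mul (by positivity)]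
          apply Real.rpow_le_rpow_of_exponent_le hp1
          push_cast
          nlinarith [(Nat.cast_nonneg k : (0:ℝ) ≤ k)]
      · rw [Finset.sum_const, Finset.card_range, nsmul_eq_mul, mul_assoc]
    have e2 : u (p^(0+1)) ≤ if p = 3 then K else 0 := by
      rw [zero_add]
      split_ifs with h3
      · simp only [hu]
        refine (mul_le_of_le_one_right (norm_nonneg _) ?_).trans (H p hp 1).1
        apply Real.rpow_le_one_of_one_le_of_nonpos
        · push_cast; simpa using hp1
        · norm_num
      · simp only [hu, pow_one]
        rw [h0 p hp h3]; simp
    simp only [ht]; linarith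
  refine summable_of_sum_range_le (c := Real.exp (∑' p, t p)) hu0 fun N => ?_
  obtain ⟨hs, hS⟩ := EulerProduct.summable_and_hasSum_smoothNumbers_prod_primesBelow_tsum hu1 humul hsum N
  have hA : ∑ i ∈ Finset.range N, u i ≤ ∏ p ∈ N.primesBelow, ∑' k, u (p^k) := by
    have hS' : HasSum (Set.indicator N.smoothNumbers u) (∏ p ∈ N.primesBelow, ∑' k, u (p^k)) :=
      (hasSum_subtype_iff_indicator (f := u)).1 hS
    refine le_trans (Finset.sum_le_sum fun i hi => ?_)
      (sum_le_hasSum (Finset.range N) (fun i _ => Set.indicator_nonneg (fun j _ => hu0 j) i) hS')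
    rcases Nat.eq_zero_or_pos i with rfl | hi0
    · simp [hu, Set.indicator_apply]
    · rw [Set.indicator_of_mem]
      rw [Nat.mem_smoothNumbers]
      refine ⟨hi0.ne', fun p hp => ?_⟩
      exact (Nat.le_of_mem_primeFactorsList hp).trans_lt (Finset.mem_range.1 hi)
  refine hA.trans ?_
  calc _ ≤ ∏ p ∈ N.primesBelow, Real.exp (t p) := by
        refine Finset.prod_le_prod (fun p _ => tsum_nonneg fun k => hu0 _) fun p hp => ?_
        refine (hloc p (Nat.prime_of_mem_primesBelow hp)).trans ?_
        linarith [Real.add_one_le_exp (t p)]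
    _ = Real.exp (∑ p ∈ N.primesBelow, t p) := (Real.exp_sum _ _).symm
    _ ≤ _ := Real.exp_le_exp.2 (hts.sum_le_tsum _ fun p _ => ht0 p)

lemma VV.PS {f : ArithmeticFunction ℂ} (hf : VV f) (h0 : ∀ p : ℕ, p.Prime → p ≠ 3 → f p = 0) :
    PS f := by
  have hs := hf.summable h0
  refine ⟨fun σ hσ => ?_, 1/4, by norm_num, by norm_num, ∑' n : ℕ, ‖f n‖ * (n:ℝ) ^ (-(3/4):ℝ),
    tsum_nonneg fun n => by positivity, fun N => ?_⟩
  · refine Summable.of_nonneg_of_le (fun n => by positivity) (fun n => ?_) hs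
    rcases Nat.eq_zero_or_pos n with rfl | hn
    · simp
    · gcongr
      · exact_mod_cast hn
      · linarith
  · have key : ∀ n ∈ Finset.Ioc 0 N, ‖f n‖ ≤ ‖f n‖ * (n:ℝ) ^ (-(3/4):ℝ) * (N:ℝ) ^ (1 - 1/4 : ℝ) := by
      intro n hn
      rw [Finset.mem_Ioc] at hn
      have hn0 : (0:ℝ) < n := by exact_mod_cast hn.1
      have hnN : (n:ℝ) ≤ N := by exact_mod_cast hn.2
      rw [mul_assoc]
      refine le_mul_of_one_le_right (norm_nonneg _) ?_
      calc (1:ℝ) = (n:ℝ) ^ (-(3/4):ℝ) * (n:ℝ) ^ (1-1/4:ℝ) := by rw [← Real.rpow_add hn0]; norm_num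
        _ ≤ _ := by gcongr
    refine (norm_sum_le_of_le _ key).trans ?_
    rw [← Finset.sum_mul]
    gcongr
    exact hs.sum_le_tsum _ fun n _ => by positivity

/-- `f_n` as a complex arithmetic function. -/
noncomputable def fA (n : ℕ) : ArithmeticFunction ℂ := ⟨fun m => (fn n m : ℂ), by simp [fn]⟩

lemma fA_apply (n m : ℕ) : fA n m = (fn n m : ℂ) := rfl

lemma fn_prime (n : ℕ) {p : ℕ} (hp : p.Prime) : fn n p = wn n p := by
  rw [fn, if_pos hp.squarefree, hp.primeFactors, Finset.prod_singleton]

lemma fn_prime_pow (n : ℕ) {p : ℕ} (hp : p.Prime) {k : ℕ} (hk : 2 ≤ k) : fn n (p^k) = 0 := by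
  rw [fn, if_neg]
  rw [Nat.squarefree_pow_iff hp.ne_one (by omega)]
  omega

lemma fA_mult (n : ℕ) : (fA n).IsMultiplicative := by
  refine ⟨by simp [fA_apply, fn], fun {a b} hab => ?_⟩
  simp only [fA_apply]
  rw [← Nat.cast_mul]
  congr 1
  simp only [fn]
  have hsq := Nat.squarefree_mul hab
  by_cases ha : Squarefree a
  · by_cases hb : Squarefree b
    · rw [if_pos (hsq.2 ⟨ha, hb⟩), if_pos ha, if_pos hb, hab.primeFactors_mul,
        Finset.prod_union hab.disjoint_primeFactors]
    · simp [hb, hsq]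
  · simp [ha, hsq]

lemma wn_le (n p : ℕ) : wn n p ≤ 9^n + 27^n := by
  unfold wn
  have h1 : 0 < 9^n := by positivity
  have h2 : 0 < 27^n := by positivity
  split_ifs <;> omega

lemma fA_VV (n : ℕ) : VV (fA n) := by
  refine ⟨fA_mult n, 1, 1 + 9^n + 27^n, by positivity, fun p hp k => ⟨?_, fun hk => ?_⟩⟩
  · rw [fA_apply, Complex.norm_natCast]
    have h1 : 0 < 9^n := by positivity
    have h2 : 0 < 27^n := by positivity
    have : fn n (p^k) ≤ 1 + 9^n + 27^n := by
      rcases k with _ | _ | k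
      · simp [fn]; omega
      · rw [zero_add, pow_one, fn_prime n hp]; have := wn_le n p; omega
      · rw [fn_prime_pow n hp (by omega)]; omega
    exact_mod_cast this
  · rw [fA_apply, fn_prime_pow n hp hk]; simp

open Classical in
/-- The exponents in the decomposition of `w_n` along characters mod 9. -/
noncomputable def bet (n : ℕ) (χ : DirichletCharacter ℂ 9) : ℕ :=
  (if χ 4 = 1 then (9^n - 1)/2 else 0) + (27^n - 9^n)/6

lemma div2 (n : ℕ) : (((9^n-1)/2 : ℕ) : ℂ) = ((9:ℂ)^n - 1)/2 := by
  have h : 2 ∣ 9^n - 1 := by simpa using (show (2:ℕ) ∣ 9 - 1 by norm_num).trans (Nat.sub_dvd_pow_sub_pow 9 1 n)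
  rw [Nat.cast_div h (by norm_num), Nat.cast_sub (Nat.one_le_pow _ _ (by norm_num))]
  push_cast; rfl

lemma div6 (n : ℕ) : (((27^n-9^n)/6 : ℕ) : ℂ) = ((27:ℂ)^n - 9^n)/6 := by
  have h : 6 ∣ 27^n - 9^n := (show (6:ℕ) ∣ 27 - 9 by norm_num).trans (Nat.sub_dvd_pow_sub_pow 27 9 n)
  rw [Nat.cast_div h (by norm_num), Nat.cast_sub (Nat.pow_le_pow_left (by norm_num) n)]
  push_cast; rfl

lemma wn_eq (n p : ℕ) :
    (wn n p : ℂ) = ∑ χ : DirichletCharacter ℂ 9, (bet n χ : ℂ) * χ (p : ZMod 9) := by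
  have key : ∀ χ : DirichletCharacter ℂ 9, (bet n χ : ℂ) * χ (p : ZMod 9) =
      ((9:ℂ)^n - 1)/6 * (χ (p : ZMod 9) + χ (4 * p : ZMod 9) + χ (7 * p : ZMod 9)) +
      ((27:ℂ)^n - 9^n)/6 * χ (p : ZMod 9) := by
    intro χ
    have h7 : χ 7 = χ 4 * χ 4 := by rw [← map_mul]; congr 1
    have h1 : χ 4 * χ 4 * χ 4 = 1 := by
      rw [← map_mul, ← map_mul, show (4 * 4 * 4 : ZMod 9) = 1 by decide, map_one]
    rw [map_mul, map_mul, h7, bet]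
    push_cast
    rw [div6]
    split_ifs with h
    · rw [div2, h]; ring
    · have h2 : 1 + χ 4 + χ 4 * χ 4 = 0 := by
        have : (χ 4 - 1) * (1 + χ 4 + χ 4 * χ 4) = 0 := by linear_combination h1
        exact (mul_eq_zero.1 this).resolve_left (sub_ne_zero.2 h)
      push_cast
      linear_combination (-(((9:ℂ)^n - 1)/6 * χ (p : ZMod 9))) * h2
  rw [Finset.sum_congr rfl fun χ _ => key χ, Finset.sum_add_distrib, ← Finset.mul_sum,
    ← Finset.mul_sum, Finset.sum_add_distrib, Finset.sum_add_distrib,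
    DirichletCharacter.sum_characters_eq, DirichletCharacter.sum_characters_eq,
    DirichletCharacter.sum_characters_eq]
  have ht : Nat.totient 9 = 6 := by decide
  rw [ht]
  have hc : (p : ZMod 9) = ((p % 9 : ℕ) : ZMod 9) := by simp
  have h9 : 1 ≤ 9^n := (Nat.one_le_pow _ _ (by norm_num))
  have h27 : 1 ≤ 27^n := (Nat.one_le_pow _ _ (by norm_num))
  have hlt : p % 9 < 9 := Nat.mod_lt _ (by norm_num)
  rw [hc, wn]
  generalize p % 9 = r at hlt
  interval_cases r <;> 
    simp [Nat.cast_sub h9, Nat.cast_sub h27,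
      show ¬ ((0:ZMod 9) = 1) by decide, show ¬ ((2:ZMod 9) = 1) by decide,
      show ¬ ((3:ZMod 9) = 1) by decide, show ¬ ((4:ZMod 9) = 1) by decide,
      show ¬ ((5:ZMod 9) = 1) by decide, show ¬ ((6:ZMod 9) = 1) by decide,
      show ¬ ((7:ZMod 9) = 1) by decide, show ¬ ((8:ZMod 9) = 1) by decide,
      show ¬ ((4*2:ZMod 9) = 1) by decide, show ¬ ((4*3:ZMod 9) = 1) by decide,
      show ¬ ((4*4:ZMod 9) = 1) by decide, show ¬ ((4*5:ZMod 9) = 1) by decide,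
      show ¬ ((4*6:ZMod 9) = 1) by decide, show ((4*7:ZMod 9) = 1) by decide,
      show ¬ ((4*8:ZMod 9) = 1) by decide, show ¬ ((7*2:ZMod 9) = 1) by decide,
      show ¬ ((7*3:ZMod 9) = 1) by decide, show ((7*4:ZMod 9) = 1) by decide,
      show ¬ ((7*5:ZMod 9) = 1) by decide, show ¬ ((7*6:ZMod 9) = 1) by decide,
      show ¬ ((7*7:ZMod 9) = 1) by decide, show ¬ ((7*8:ZMod 9) = 1) by decide] <;> ring

/-- The exponent `α` as a natural number. -/
def aa (n : ℕ) : ℕ := (9^n - 1)/2 + (27^n - 9^n)/6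

lemma bet_one (n : ℕ) : bet n 1 = aa n := by
  have : (1 : DirichletCharacter ℂ 9) 4 = 1 := MulChar.one_apply (by decide)
  rw [bet, if_pos this, aa]

lemma aa_cast (n : ℕ) : (aa n : ℝ) = ((9 : ℝ) ^ n - 1) / 3 + ((27 : ℝ) ^ n - 1) / 6 := by
  have : ((aa n : ℝ) : ℂ) = (((9 : ℝ) ^ n - 1) / 3 + ((27 : ℝ) ^ n - 1) / 6 : ℝ) := by
    rw [aa]; push_cast; rw [div2, div6]; ring
  exact_mod_cast this

lemma aa_pos (n : ℕ) (hn : 1 ≤ n) : 1 ≤ aa n := by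
  have : 9^1 ≤ 9^n := Nat.pow_le_pow_right (by norm_num) hn
  rw [aa]; omega

open Classical in
/-- The non-trivial characters mod 9. -/
noncomputable def ntc : Finset (DirichletCharacter ℂ 9) := Finset.univ.erase 1

lemma wn_eq' (n : ℕ) {p : ℕ} (hp : p.Prime) (h3 : p ≠ 3) :
    (wn n p : ℂ) = aa n + ∑ χ ∈ ntc, (bet n χ : ℂ) * χ (p : ZMod 9) := by
  classical
  rw [wn_eq, ← Finset.add_sum_erase _ _ (Finset.mem_univ (1 : DirichletCharacter ℂ 9)), bet_one]
  have hu : IsUnit (p : ZMod 9) := by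
    rw [ZMod.isUnit_iff_coprime]
    exact (Nat.coprime_primes hp Nat.prime_three).2 h3 |>.pow_right 2
  rw [MulChar.one_apply hu, mul_one, ntc]

/-- `b = f * μ^a`. -/
noncomputable def bA (n : ℕ) : ArithmeticFunction ℂ := fA n * (μ : ArithmeticFunction ℂ) ^ (aa n)

lemma bA_mul_zeta (n : ℕ) : bA n * (ζ : ArithmeticFunction ℂ) ^ (aa n) = fA n := by
  rw [bA, mul_assoc, ← mul_pow, coe_moebius_mul_coe_zeta, one_pow, mul_one]

lemma bA_PS (n : ℕ) : PS (bA n) := by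
  set h : ArithmeticFunction ℂ := bA n *
    ∏ χ ∈ ntc, ((chiA χ).pmul (μ : ArithmeticFunction ℂ)) ^ (bet n χ) with hh
  have hV : VV (∏ χ ∈ ntc, ((chiA χ).pmul (μ : ArithmeticFunction ℂ)) ^ (bet n χ)) :=
    VV.prod _ _ fun χ _ => (VV.twist χ).pow _
  have hVb : VV (bA n) := (fA_VV n).mul (VV.moebius.pow _)
  have hp : ∀ p : ℕ, p.Prime → p ≠ 3 → h p = 0 := by
    intro p hp h3
    rw [hh, mul_prime hVb.mult.1 hV.mult.1 hp, prod_prime _ _ (fun χ _ => (VV.twist χ).pow _) hp,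
      bA, mul_prime (fA_VV n).mult.1 (VV.moebius.pow _).mult.1 hp, pow_prime VV.moebius hp]
    have : ∀ χ ∈ ntc, (((chiA χ).pmul (μ : ArithmeticFunction ℂ)) ^ (bet n χ)) p =
        - ((bet n χ : ℂ) * χ (p : ZMod 9)) := by
      intro χ _
      rw [pow_prime (VV.twist χ) hp, pmul_apply, intCoe_apply, moebius_apply_prime hp, chiA_apply]
      push_cast; ring
    rw [Finset.sum_congr rfl this, Finset.sum_neg_distrib, fA_apply, fn_prime n hp, wn_eq' n hp h3,
      intCoe_apply, moebius_apply_prime hp]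
    push_cast; ring
  have e : bA n = h * ∏ χ ∈ ntc, (chiA χ) ^ (bet n χ) := by
    rw [hh, mul_assoc, ← Finset.prod_mul_distrib]
    have : ∀ χ ∈ ntc, ((chiA χ).pmul (μ : ArithmeticFunction ℂ)) ^ (bet n χ) * (chiA χ) ^ (bet n χ) = 1 := by
      intro χ _
      rw [← mul_pow, mul_comm, chiA_mul_inv, one_pow]
    rw [Finset.prod_congr rfl this, Finset.prod_const_one, mul_one]
  rw [e]
  refine ((hVb.mul hV).PS hp).mul (PS.prod _ _ fun χ hχ => (chiA_PS χ ?_).pow _)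
  exact Finset.ne_of_mem_erase hχ

end

section
open Filter Topology ArithmeticFunction
open scoped ArithmeticFunction.Moebius ArithmeticFunction.zeta

lemma sum_range_eq_Ioc {M : Type*} [AddCommMonoid M] (g : ℕ → M) (N : ℕ) :
    ∑ i ∈ Finset.range N, g (i+1) = ∑ i ∈ Finset.Ioc 0 N, g i := by
  induction N with
  | zero => simp
  | succ N ih => rw [Finset.sum_range_succ, ih, Finset.sum_Ioc_succ_top (by omega)]

lemma cpow_split (n : ℕ) (ε : ℝ) : ((n + 1 : ℕ) : ℂ) ^ ((1 + ε : ℝ) : ℂ) =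
    ((((n:ℝ) + 1) ^ ε : ℝ) : ℂ) * ((n:ℂ) + 1) := by
  have h : (0:ℝ) < (n:ℝ) + 1 := by positivity
  have e : ((n + 1 : ℕ) : ℂ) = (((n:ℝ) + 1 : ℝ) : ℂ) := by push_cast; rfl
  rw [e, ← Complex.ofReal_cpow h.le, Real.rpow_add h, Real.rpow_one, mul_comm]
  push_cast; rfl

lemma PS.tendsto_LSeries {b : ArithmeticFunction ℂ} (h : PS b) {l : ℂ}
    (hl : Tendsto (fun N => ∑ n ∈ Finset.range N, b (n+1) / ((n:ℂ)+1)) atTop (𝓝 l)) :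
    Tendsto (fun ε : ℝ => LSeries (fun n => b n) ((1 + ε : ℝ) : ℂ)) (𝓝[>] 0) (𝓝 l) := by
  refine abel_dirichlet _ l _ hl fun ε hε => ?_
  have hs := (LSeriesSummable_iff' b (1+ε)).2 (h.summ (1+ε) (by linarith))
  have ht := (tendsto_add_atTop_iff_nat 1).2 hs.hasSum.tendsto_sum_nat
  refine ht.congr fun N => ?_
  rw [Finset.sum_range_succ', LSeries.term_zero, add_zero]
  refine Finset.sum_congr rfl fun n _ => ?_
  rw [LSeries.term_of_ne_zero (by omega), cpow_split, Real.rpow_neg (by positivity)]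
  push_cast
  rw [div_mul_eq_div_div, div_eq_mul_inv, div_eq_mul_inv, div_eq_mul_inv]
  ring

lemma chi_limit_ne_zero (χ : DirichletCharacter ℂ 9) (hχ : χ ≠ 1) {l : ℂ}
    (hl : Tendsto (fun N => ∑ n ∈ Finset.range N, chiA χ (n+1) / ((n:ℂ)+1)) atTop (𝓝 l)) : l ≠ 0 := by
  have h1 := (chiA_PS χ hχ).tendsto_LSeries hl
  have h2 : Tendsto (fun ε : ℝ => DirichletCharacter.LFunction χ ((1 + ε : ℝ) : ℂ)) (𝓝[>] 0)
      (𝓝 (DirichletCharacter.LFunction χ 1)) := by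
    have hc : Continuous fun ε : ℝ => DirichletCharacter.LFunction χ ((1 + ε : ℝ) : ℂ) :=
      (DirichletCharacter.differentiable_LFunction hχ).continuous.comp (by fun_prop)
    have := hc.tendsto 0
    simp only [add_zero, Complex.ofReal_one] at this
    exact this.mono_left nhdsWithin_le_nhds
  have h3 : Tendsto (fun ε : ℝ => LSeries (fun n => chiA χ n) ((1 + ε : ℝ) : ℂ)) (𝓝[>] 0)
      (𝓝 (DirichletCharacter.LFunction χ 1)) := by
    refine h2.congr' ?_
    filter_upwards [self_mem_nhdsWithin] with ε hε
    rw [DirichletCharacter.LFunction_eq_LSeries]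
    · rfl
    · rw [Complex.ofReal_re]; linarith [Set.mem_Ioi.1 hε]
  rw [tendsto_nhds_unique h1 h3]
  exact DirichletCharacter.LFunction_apply_one_ne_zero hχ

lemma chi_shift_bound (χ : DirichletCharacter ℂ 9) (hχ : χ ≠ 1) (y N : ℕ) :
    ‖∑ i ∈ Finset.range N, χ ((y + i : ℕ) : ZMod 9)‖ ≤ 18 := by
  have h := Finset.sum_range_add (fun i : ℕ => χ (i : ZMod 9)) y N
  have e : ∑ i ∈ Finset.range N, χ ((y + i : ℕ) : ZMod 9) =
      ∑ i ∈ Finset.range (y+N), χ (i : ZMod 9) - ∑ i ∈ Finset.range y, χ (i : ZMod 9) := by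
    rw [h]; ring
  rw [e]
  linarith [norm_sub_le (∑ i ∈ Finset.range (y+N), χ (i : ZMod 9)) (∑ i ∈ Finset.range y, χ (i : ZMod 9)),
    chi_range_bound χ hχ (y+N), chi_range_bound χ hχ y]

lemma chi_tail (χ : DirichletCharacter ℂ 9) (hχ : χ ≠ 1) {l : ℂ}
    (hl : Tendsto (fun N => ∑ n ∈ Finset.range N, chiA χ (n+1) / ((n:ℂ)+1)) atTop (𝓝 l)) (y : ℕ) :
    ‖∑ k ∈ Finset.Ioc 0 y, chiA χ k / k - l‖ ≤ 18 / ((y:ℝ)+1) := by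
  have e0 : ∑ k ∈ Finset.Ioc 0 y, chiA χ k / k = ∑ n ∈ Finset.range y, chiA χ (n+1) / ((n:ℂ)+1) := by
    rw [← sum_range_eq_Ioc (fun k => chiA χ k / (k:ℂ))]
    push_cast; rfl
  rw [e0]
  have hM : ∀ M : ℕ, ‖∑ n ∈ Finset.range y, chiA χ (n+1) / ((n:ℂ)+1) -
      ∑ n ∈ Finset.range (M + y), chiA χ (n+1) / ((n:ℂ)+1)‖ ≤ 18 / ((y:ℝ)+1) := by
    intro M
    rw [add_comm M y, Finset.sum_range_add, sub_add_cancel_left, norm_neg]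
    have := abel_ineq (fun i : ℕ => 1 / ((y:ℝ) + i + 1)) (fun i => χ ((y + 1 + i : ℕ) : ZMod 9)) 18
      (fun i j hij => by
        have : (i:ℝ) ≤ j := by exact_mod_cast hij
        dsimp only
        gcongr)
      (fun i => by positivity) (chi_shift_bound χ hχ (y+1)) M
    simp only [Nat.cast_zero, add_zero, mul_one_div] at this
    refine le_of_eq_of_le (congrArg _ (Finset.sum_congr rfl fun i _ => ?_)) this
    rw [chiA_apply, show y + i + 1 = y + 1 + i by ring]
    push_cast
    ring
  have ht := ((tendsto_const_nhds (x := ∑ n ∈ Finset.range y, chiA χ (n+1) / ((n:ℂ)+1))).sub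
    ((tendsto_add_atTop_iff_nat y).2 hl)).norm
  exact le_of_tendsto ht (Eventually.of_forall hM)

lemma chi_log_bound (χ : DirichletCharacter ℂ 9) (hχ : χ ≠ 1) : ∃ B : ℝ, ∀ N : ℕ,
    ‖∑ n ∈ Finset.Ioc 0 N, chiA χ n * Real.log n / n‖ ≤ B := by
  have hanti : Antitone (fun i : ℕ => Real.log ((i:ℝ)+3) / ((i:ℝ)+3)) := by
    intro i j hij
    have : (i:ℝ) ≤ j := by exact_mod_cast hij
    have he : Real.exp 1 ≤ 3 := by linarith [Real.exp_one_lt_d9]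
    refine Real.log_div_self_antitoneOn ?_ ?_ (by linarith)
    · rw [Set.mem_Ici]; linarith [(Nat.cast_nonneg i : (0:ℝ) ≤ i)]
    · rw [Set.mem_Ici]; linarith [(Nat.cast_nonneg j : (0:ℝ) ≤ j)]
  obtain ⟨Q, h⟩ : ∃ Q, ∀ N, ‖∑ i ∈ Finset.range N, ((Real.log ((i:ℝ)+3) / ((i:ℝ)+3) : ℝ) : ℂ) *
        χ ((3 + i : ℕ) : ZMod 9)‖ ≤ Q := ⟨_, fun N => abel_ineq (fun i : ℕ => Real.log ((i:ℝ)+3) / ((i:ℝ)+3))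
    (fun i => χ ((3 + i : ℕ) : ZMod 9)) 18 hanti
      (fun i => div_nonneg (Real.log_nonneg (by linarith [(Nat.cast_nonneg i : (0:ℝ) ≤ i)])) (by positivity))
      (chi_shift_bound χ hχ 3) N⟩
  set S : ℕ → ℂ := fun N => ∑ n ∈ Finset.range N, chiA χ (n+1) * Real.log (n+1 : ℕ) / (n+1 : ℕ)
  have hS : ∀ N, ∑ n ∈ Finset.Ioc 0 N, chiA χ n * Real.log n / n = S N := fun N =>
    (sum_range_eq_Ioc (fun n => chiA χ n * Real.log n / n) N).symm
  refine ⟨‖S 0‖ + ‖S 1‖ + ‖S 2‖ + Q, fun N => ?_⟩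
  have hpos := (norm_nonneg _).trans (h 0)
  rw [hS]
  rcases N with _ | _ | N
  · linarith [norm_nonneg (S 1), norm_nonneg (S 2)]
  · rw [zero_add]; linarith [norm_nonneg (S 0), norm_nonneg (S 2)]
  · have e : S (N+1+1) = S 2 + ∑ i ∈ Finset.range N, ((Real.log ((i:ℝ)+3) / ((i:ℝ)+3) : ℝ) : ℂ) *
        χ ((3 + i : ℕ) : ZMod 9) := by
      simp only [S]
      rw [show N + 1 + 1 = 2 + N by ring, Finset.sum_range_add]
      congr 1
      refine Finset.sum_congr rfl fun i _ => ?_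
      rw [chiA_apply, show 2 + i + 1 = 3 + i by ring, show ((3 + i : ℕ) : ℝ) = (i:ℝ) + 3 by push_cast; ring]
      push_cast
      rw [add_comm (i:ℂ) 3]
      ring
    rw [e]
    refine (norm_add_le _ _).trans ?_
    have h1 := norm_nonneg (S 0)
    have h2 := norm_nonneg (S 1)
    exact add_le_add (by linarith) (h N)

lemma chi_vonMangoldt_bound (χ : DirichletCharacter ℂ 9) (hχ : χ ≠ 1) : ∃ B : ℝ, ∀ N : ℕ,
    ‖∑ n ∈ Finset.Ioc 0 N, chiA χ n * vonMangoldt n / n‖ ≤ B := by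
  obtain ⟨l, hl⟩ := (chiA_PS χ hχ).converges
  have hl0 := chi_limit_ne_zero χ hχ hl
  obtain ⟨B, hB⟩ := chi_log_bound χ hχ
  let A1 : ArithmeticFunction ℂ := ⟨fun n => chiA χ n * vonMangoldt n / n, by simp⟩
  let A2 : ArithmeticFunction ℂ := ⟨fun n => chiA χ n / n, by simp⟩
  have hA1 : ∀ n, A1 n = chiA χ n * vonMangoldt n / n := fun n => rfl
  have hA2 : ∀ n, A2 n = chiA χ n / n := fun n => rfl
  have hconv : ∀ n, (A1 * A2) n = chiA χ n * Real.log n / n := by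
    intro n
    rw [ArithmeticFunction.mul_apply]
    have : ∀ x ∈ n.divisorsAntidiagonal, A1 x.1 * A2 x.2 = chiA χ n / n * (vonMangoldt x.1 : ℂ) := by
      intro x hx
      rw [Nat.mem_divisorsAntidiagonal] at hx
      have hx0 := hx.2
      rw [← hx.1] at hx0
      have h1 : (x.1:ℂ) ≠ 0 := by exact_mod_cast left_ne_zero_of_mul hx0
      have h2 : (x.2:ℂ) ≠ 0 := by exact_mod_cast right_ne_zero_of_mul hx0
      rw [hA1, hA2, ← hx.1, chiA_apply, chiA_apply, chiA_apply, Nat.cast_mul, map_mul, Nat.cast_mul]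
      field_simp
    rw [Finset.sum_congr rfl this, ← Finset.mul_sum,
      Nat.sum_divisorsAntidiagonal (fun a _ => (vonMangoldt a : ℂ)), ← Complex.ofReal_sum, vonMangoldt_sum]
    ring
  have key : ∀ N : ℕ, ‖l * ∑ n ∈ Finset.Ioc 0 N, A1 n‖ ≤ B + 18 * (Real.log 4 + 4) := by
    intro N
    rcases Nat.eq_zero_or_pos N with rfl | hN
    · simp
      have h0 : 0 ≤ B := (norm_nonneg _).trans (hB 0)
      positivity
    have hN0 : (0:ℝ) < N := by exact_mod_cast hN
    have h1 := sum_Ioc_mul_eq_sum_sum A1 A2 N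
    simp only [hconv] at h1
    have h2 : l * ∑ n ∈ Finset.Ioc 0 N, A1 n = ∑ n ∈ Finset.Ioc 0 N, chiA χ n * Real.log n / n -
        ∑ n ∈ Finset.Ioc 0 N, A1 n * (∑ m ∈ Finset.Ioc 0 (N / n), A2 m - l) := by
      rw [h1]; simp only [mul_sub, Finset.sum_sub_distrib, ← Finset.sum_mul]; ring
    rw [h2]
    refine (norm_sub_le _ _).trans (add_le_add (hB N) ?_)
    calc _ ≤ ∑ n ∈ Finset.Ioc 0 N, 18 / (N:ℝ) * vonMangoldt n := by
          refine norm_sum_le_of_le _ fun n hn => ?_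
          rw [Finset.mem_Ioc] at hn
          have hn0 : (0:ℝ) < n := by exact_mod_cast hn.1
          rw [norm_mul, hA1]
          have e1 : ‖chiA χ n * vonMangoldt n / n‖ ≤ vonMangoldt n / n := by
            rw [norm_div, norm_mul, Complex.norm_natCast, Complex.norm_real, Real.norm_eq_abs,
              abs_of_nonneg vonMangoldt_nonneg]
            gcongr
            exact mul_le_of_le_one_left vonMangoldt_nonneg (chiA_norm_le χ n)
          have e2 := chi_tail χ hχ hl (N / n)
          have e3 : (18:ℝ) / (((N/n : ℕ):ℝ) + 1) ≤ 18 * n / N := by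
            rw [div_le_div_iff₀ (by positivity) hN0]
            have : N < n * (N / n + 1) := Nat.lt_mul_div_succ N hn.1
            have : (N:ℝ) < n * (((N / n : ℕ) : ℝ) + 1) := by exact_mod_cast this
            nlinarith
          calc _ ≤ vonMangoldt n / n * (18 * n / N) :=
                mul_le_mul e1 (e2.trans e3) (norm_nonneg _) (div_nonneg vonMangoldt_nonneg hn0.le)
            _ = _ := by field_simp
      _ = 18 / (N:ℝ) * Chebyshev.psi N := by
          rw [← Finset.mul_sum, Chebyshev.psi, Nat.floor_natCast]
      _ ≤ 18 / (N:ℝ) * ((Real.log 4 + 4) * N) := by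
          gcongr
          exact Chebyshev.psi_le_const_mul_self hN0.le
      _ = _ := by field_simp
  refine ⟨(B + 18 * (Real.log 4 + 4)) / ‖l‖, fun N => ?_⟩
  rw [le_div_iff₀ (norm_pos_iff.2 hl0), mul_comm, ← norm_mul]
  exact key N

lemma summable_nonprimes : Summable fun n : ℕ => (if n.Prime then 0 else vonMangoldt n) / n := by
  have h := ArithmeticFunction.vonMangoldt.summable_residueClass_non_primes_div (q := 1) 0
  refine h.congr fun n => ?_
  congr 1
  split_ifs
  · rfl
  · rw [vonMangoldt.residueClass, Set.indicator_of_mem]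
    exact Subsingleton.elim (α := ZMod 1) _ _

lemma chi_primes_log_bound (χ : DirichletCharacter ℂ 9) (hχ : χ ≠ 1) : ∃ B : ℝ, ∀ N : ℕ,
    ‖∑ n ∈ Finset.Ioc 0 N, if n.Prime then chiA χ n * Real.log n / n else 0‖ ≤ B := by
  obtain ⟨B, hB⟩ := chi_vonMangoldt_bound χ hχ
  have hs := summable_nonprimes
  have hnn : ∀ n : ℕ, 0 ≤ (if n.Prime then 0 else vonMangoldt n) / n := fun n => by
    split_ifs
    · simp
    · exact div_nonneg vonMangoldt_nonneg (by positivity)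
  refine ⟨B + ∑' n : ℕ, (if n.Prime then 0 else vonMangoldt n) / n, fun N => ?_⟩
  have e : ∑ n ∈ Finset.Ioc 0 N, (if n.Prime then chiA χ n * Real.log n / n else 0) =
      ∑ n ∈ Finset.Ioc 0 N, chiA χ n * vonMangoldt n / n -
      ∑ n ∈ Finset.Ioc 0 N, if n.Prime then 0 else chiA χ n * vonMangoldt n / n := by
    rw [← Finset.sum_sub_distrib]
    refine Finset.sum_congr rfl fun n _ => ?_
    split_ifs with h
    · rw [vonMangoldt_apply_prime h, sub_zero]
    · ring
  rw [e]
  refine (norm_sub_le _ _).trans (add_le_add (hB N) ?_)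
  refine (norm_sum_le_of_le (n := fun n : ℕ => (if n.Prime then 0 else vonMangoldt n) / n) _ fun n _ => ?_).trans
    (hs.sum_le_tsum _ fun n _ => hnn n)
  split_ifs
  · simp
  · rw [norm_div, norm_mul, Complex.norm_natCast, Complex.norm_real, Real.norm_eq_abs,
      abs_of_nonneg vonMangoldt_nonneg]
    gcongr
    exact mul_le_of_le_one_left vonMangoldt_nonneg (chiA_norm_le χ n)

/-- `∑ χ(p)/p` converges. -/
lemma chi_primes_converges (χ : DirichletCharacter ℂ 9) (hχ : χ ≠ 1) : ∃ l : ℂ,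
    Tendsto (fun N => ∑ n ∈ Finset.range N,
      if (n+1).Prime then χ ((n+1 : ℕ) : ZMod 9) / ((n:ℂ)+1) else 0) atTop (𝓝 l) := by
  obtain ⟨B, hB⟩ := chi_primes_log_bound χ hχ
  set z : ℕ → ℂ := fun i => if (i+2).Prime then chiA χ (i+2) * Real.log (i+2 : ℕ) / (i+2 : ℕ) else 0
    with hz
  have hzb : ∀ N, ‖∑ i ∈ Finset.range N, z i‖ ≤ B := by
    intro N
    refine le_of_eq_of_le (congrArg _ ?_) (hB (N+1))
    rw [← sum_range_eq_Ioc (fun n => if n.Prime then chiA χ n * Real.log n / n else 0),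
      Finset.sum_range_succ', if_neg (by decide), add_zero]
  have hanti : Antitone (fun i : ℕ => 1 / Real.log ((i:ℝ)+2)) := by
    intro i j hij
    have : (i:ℝ) ≤ j := by exact_mod_cast hij
    have h0 : 0 < Real.log ((i:ℝ)+2) := Real.log_pos (by linarith [(Nat.cast_nonneg i : (0:ℝ) ≤ i)])
    dsimp only
    gcongr
  have h0 : Tendsto (fun i : ℕ => 1 / Real.log ((i:ℝ)+2)) atTop (𝓝 0) := by
    simp only [one_div]
    exact (Real.tendsto_log_atTop.comp
      (tendsto_atTop_add_const_right _ _ tendsto_natCast_atTop_atTop)).inv_tendsto_atTop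
  obtain ⟨l, hl⟩ := cauchySeq_tendsto_of_complete
    (hanti.cauchySeq_series_mul_of_tendsto_zero_of_bounded h0 hzb)
  refine ⟨l, (tendsto_add_atTop_iff_nat 1).1 (hl.congr fun N => ?_)⟩
  rw [Finset.sum_range_succ', if_neg (by decide), add_zero]
  refine Finset.sum_congr rfl fun i _ => ?_
  simp only [hz]
  have hlog : (Real.log ((i:ℝ)+2) : ℂ) ≠ 0 := by
    have h0 : 0 < Real.log ((i:ℝ)+2) := Real.log_pos (by linarith [(Nat.cast_nonneg i : (0:ℝ) ≤ i)])
    exact_mod_cast h0.ne'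
  rw [show i + 1 + 1 = i + 2 by ring]
  split_ifs
  · rw [chiA_apply, Complex.real_smul, show ((i + 2 : ℕ) : ℝ) = (i:ℝ) + 2 by push_cast; ring]
    push_cast
    have e : (i:ℂ) + 1 + 1 = (i:ℂ) + 2 := by ring
    rw [e]
    field_simp
  · simp

end

section
open Filter Topology ArithmeticFunction
open scoped ArithmeticFunction.Moebius ArithmeticFunction.zeta

lemma euler_sqfree {h : ArithmeticFunction ℂ} (hm : h.IsMultiplicative)
    (h2 : ∀ p k : ℕ, p.Prime → 2 ≤ k → h (p^k) = 0) {σ : ℝ}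
    (hs : LSeriesSummable (fun n => h n) (σ:ℂ)) :
    Tendsto (fun N : ℕ => ∏ p ∈ Nat.primesBelow N, (1 + h p / (p:ℂ)^(σ:ℂ))) atTop
      (𝓝 (LSeries (fun n => h n) (σ:ℂ))) := by
  have key := EulerProduct.eulerProduct (R := ℂ) (f := LSeries.term (fun n => h n) (σ:ℂ))
    (by simp [LSeries.term, hm.1]) (by
      intro m n hmn
      rcases eq_or_ne m 0 with rfl | hm0
      · simp
      rcases eq_or_ne n 0 with rfl | hn0
      · simp
      rw [LSeries.term_of_ne_zero (by positivity), LSeries.term_of_ne_zero hm0,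
        LSeries.term_of_ne_zero hn0, hm.map_mul_of_coprime hmn, Nat.cast_mul,
        Complex.natCast_mul_natCast_cpow]
      ring)
    hs.norm (by simp)
  refine key.congr fun N => ?_
  refine Finset.prod_congr rfl fun p hp => ?_
  have hp := (Nat.mem_primesBelow.1 hp).2
  rw [tsum_eq_sum (s := {0,1})]
  · rw [Finset.sum_pair (by norm_num), pow_zero, pow_one, LSeries.term_of_ne_zero one_ne_zero,
      LSeries.term_of_ne_zero hp.ne_zero]
    simp [hm.1]
  · intro k hk
    simp only [Finset.mem_insert, Finset.mem_singleton, not_or] at hk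
    rw [LSeries.term_of_ne_zero (pow_ne_zero _ hp.ne_zero), h2 p k hp (by omega), zero_div]

lemma zeta_summable {σ : ℝ} (hσ : 1 < σ) : LSeriesSummable (fun n => (ζ : ArithmeticFunction ℂ) n) (σ:ℂ) := by
  have := (LSeriesSummable_zeta_iff (s := (σ:ℂ))).2 (by simpa using hσ)
  refine this.congr ?_ 
  simp

lemma moebius_summable {σ : ℝ} (hσ : 1 < σ) : LSeriesSummable (fun n => (μ : ArithmeticFunction ℂ) n) (σ:ℂ) := by
  have := (LSeriesSummable_moebius_iff (s := (σ:ℂ))).2 (by simpa using hσ)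
  simpa using this

lemma LSpow {h : ArithmeticFunction ℂ} {s : ℂ} (hs : LSeriesSummable (fun n => h n) s) (k : ℕ) :
    LSeriesSummable (fun n => (h^k) n) s ∧ LSeries (fun n => (h^k) n) s = (LSeries (fun n => h n) s)^k := by
  induction k with
  | zero => 
    have h1 : (fun n => (h^0) n) = LSeries.delta := by
      funext n; rw [pow_zero, ArithmeticFunction.one_apply, LSeries.delta]
    rw [h1, pow_zero]
    constructor
    · refine summable_of_ne_finset_zero (s := {1}) fun m hm => ?_
      rw [Finset.mem_singleton] at hm
      rcases eq_or_ne m 0 with rfl | h0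
      · simp
      · rw [LSeries.term_of_ne_zero h0]; simp [LSeries.delta, hm]
    · simp [LSeries_delta]
  | succ k ih =>
    rw [pow_succ]
    exact ⟨LSeriesSummable_mul ih.1 hs, by rw [LSeries_mul' ih.1 hs, ih.2, pow_succ]⟩

lemma bA_LSeries (n : ℕ) {σ : ℝ} (hσ : 1 < σ) : LSeriesSummable (fun m => fA n m) (σ:ℂ) ∧ 
    LSeries (fun m => bA n m) (σ:ℂ) = LSeries (fun m => fA n m) (σ:ℂ) * (LSeries (fun m => (μ : ArithmeticFunction ℂ) m) (σ:ℂ))^(aa n) := by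
  have h1 : LSeriesSummable (fun m => fA n m) (σ:ℂ) := by
    rw [← bA_mul_zeta]
    exact LSeriesSummable_mul ((LSeriesSummable_iff' _ _).2 ((bA_PS n).summ σ hσ)) (LSpow (zeta_summable hσ) _).1
  refine ⟨h1, ?_⟩
  have h2 := LSpow (moebius_summable hσ) (aa n)
  rw [bA, LSeries_mul' h1 h2.1, h2.2]

lemma bA_euler (n : ℕ) {σ : ℝ} (hσ : 1 < σ) :
    Tendsto (fun N : ℕ => ∏ p ∈ Nat.primesBelow N, (((1 + wn n p * (p:ℝ)^(-σ)) * (1 - (p:ℝ)^(-σ))^(aa n) : ℝ) : ℂ)) atTop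
      (𝓝 (LSeries (fun m => bA n m) (σ:ℂ))) := by
  obtain ⟨h1, h2⟩ := bA_LSeries n hσ
  rw [h2]
  have e1 := euler_sqfree (fA_mult n) (fun p k hp hk => by rw [fA_apply, fn_prime_pow n hp hk]; simp) h1
  have e2 := euler_sqfree (h := (μ : ArithmeticFunction ℂ)) isMultiplicative_moebius.intCast (fun p k hp hk => by 
    rw [ArithmeticFunction.intCoe_apply, ArithmeticFunction.moebius_apply_prime_pow hp (by omega), if_neg (by omega)]; simp) (moebius_summable hσ)
  refine (e1.mul (e2.pow (aa n))).congr fun N => ?_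
  rw [← Finset.prod_pow, ← Finset.prod_mul_distrib]
  refine Finset.prod_congr rfl fun p hp => ?_
  have hp := (Nat.mem_primesBelow.1 hp).2
  have hc : ((p:ℂ)^(σ:ℂ)) = (((p:ℝ)^σ : ℝ) : ℂ) := by
    rw [Complex.ofReal_cpow (by positivity)]; simp
  rw [fA_apply, fn_prime n hp, hc, ArithmeticFunction.intCoe_apply, ArithmeticFunction.moebius_apply_prime hp,
    Real.rpow_neg (by positivity)]
  push_cast
  congr 2
  ring

end

section
open Filter Topology ArithmeticFunction
open scoped ArithmeticFunction.Moebius ArithmeticFunction.zeta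

lemma primesBelow_prod {M : Type*} [CommMonoid M] (g : ℕ → M) (N : ℕ) :
    ∏ p ∈ Nat.primesBelow (N+1), g p = ∏ m ∈ Finset.range N, if (m+1).Prime then g (m+1) else 1 := by
  rw [Nat.primesBelow, Finset.prod_filter, Finset.prod_range_succ']
  simp [Nat.not_prime_zero]

noncomputable def thm (n m : ℕ) : ℝ := if (m+1).Prime then (wn n (m+1) : ℝ) - aa n else 0

lemma thm_converges (n : ℕ) : ∃ l : ℂ, Tendsto (fun N : ℕ => ∑ m ∈ Finset.range N, ((thm n m / ((m:ℝ)+1) : ℝ) : ℂ)) atTop (𝓝 l) := by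
  have hex : ∀ χ : DirichletCharacter ℂ 9, ∃ l : ℂ, χ ≠ 1 → Tendsto (fun N : ℕ => ∑ n ∈ Finset.range N, if (n+1).Prime then χ ((n+1:ℕ):ZMod 9)/((n:ℂ)+1) else 0) atTop (𝓝 l) := by
    intro χ
    by_cases h : χ = 1
    · exact ⟨0, fun h' => absurd h h'⟩
    · obtain ⟨l, hl⟩ := chi_primes_converges χ h
      exact ⟨l, fun _ => hl⟩
  choose L hL using hex
  set corr : ℕ → ℂ := fun m => ((thm n m / ((m:ℝ)+1) : ℝ) : ℂ) - ∑ χ ∈ ntc, (bet n χ : ℂ) * (if (m+1).Prime then χ ((m+1:ℕ):ZMod 9)/((m:ℂ)+1) else 0) with hcorr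
  have hc0 : ∀ m, m ∉ ({2} : Finset ℕ) → corr m = 0 := by
    intro m hm
    rw [Finset.mem_singleton] at hm
    simp only [hcorr, thm]
    by_cases hp : (m+1).Prime
    · simp only [hp, if_true]
      have := wn_eq' n hp (by omega)
      push_cast at this ⊢
      rw [this, add_sub_cancel_left, Finset.sum_div, sub_eq_zero]
      refine Finset.sum_congr rfl fun χ _ => ?_
      ring
    · simp [hp]
  have hcs : Tendsto (fun N : ℕ => ∑ m ∈ Finset.range N, corr m) atTop (𝓝 (∑ m ∈ ({2} : Finset ℕ), corr m)) :=
    (hasSum_sum_of_ne_finset_zero hc0).tendsto_sum_nat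
  have hmain : Tendsto (fun N : ℕ => ∑ χ ∈ ntc, (bet n χ : ℂ) * ∑ m ∈ Finset.range N, (if (m+1).Prime then χ ((m+1:ℕ):ZMod 9)/((m:ℂ)+1) else 0)) atTop (𝓝 (∑ χ ∈ ntc, (bet n χ : ℂ) * L χ)) := 
    tendsto_finsetSum _ fun χ hχ => (hL χ (Finset.ne_of_mem_erase hχ)).const_mul _
  refine ⟨_, (hcs.add hmain).congr fun N => ?_⟩
  simp only [Finset.mul_sum]
  rw [Finset.sum_comm, ← Finset.sum_add_distrib]
  refine Finset.sum_congr rfl fun m _ => ?_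
  simp only [hcorr]
  ring

noncomputable def gg (n : ℕ) (ε : ℝ) (m : ℕ) : ℝ := if (m+1).Prime then
  Real.log (1 + wn n (m+1) * ((m:ℝ)+1)^(-(1+ε))) + aa n * Real.log (1 - ((m:ℝ)+1)^(-(1+ε))) else 0

noncomputable def rr (n : ℕ) (ε : ℝ) (m : ℕ) : ℝ := gg n ε m - thm n m * ((m:ℝ)+1)^(-(1+ε))

lemma log_est {w a x : ℝ} (hw : 0 ≤ w) (ha : 0 ≤ a) (hx : 0 ≤ x) (hx2 : x ≤ 1/2) :
    |Real.log (1 + w * x) + a * Real.log (1 - x) - (w - a) * x| ≤ (w^2 + 2*a) * x^2 := by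
  have h1 : Real.log (1 + w*x) ≤ w*x := by
    have := Real.log_le_sub_one_of_pos (show 0 < 1 + w*x by positivity); linarith
  have h2 : w*x - (w*x)^2 ≤ Real.log (1+w*x) := by
    have := Real.one_sub_inv_le_log_of_pos (show 0 < 1 + w*x by positivity)
    refine le_trans ?_ this
    have hy : 0 ≤ w*x := by positivity
    have : (1+w*x)⁻¹ ≤ 1 - w*x + (w*x)^2 := by
      rw [inv_le_iff_one_le_mul₀ (by positivity)]
      nlinarith [pow_nonneg hy 3]
    linarith
  have h3 : Real.log (1 - x) ≤ -x := by
    have := Real.log_le_sub_one_of_pos (show 0 < 1 - x by linarith); linarith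
  have h4 : -x - 2*x^2 ≤ Real.log (1-x) := by
    have := Real.one_sub_inv_le_log_of_pos (show 0 < 1 - x by linarith)
    refine le_trans ?_ this
    have : (1-x)⁻¹ ≤ 1 + x + 2*x^2 := by
      rw [inv_le_iff_one_le_mul₀ (by linarith)]
      nlinarith [sq_nonneg x, mul_nonneg (sq_nonneg x) (show 0 ≤ 1 - 2*x by linarith)]
    linarith
  have h5 := mul_le_mul_of_nonneg_left h3 ha
  have h6 := mul_le_mul_of_nonneg_left h4 ha
  rw [abs_le]
  constructor
  · nlinarith
  · nlinarith [mul_nonneg (sq_nonneg w) (sq_nonneg x), mul_nonneg ha (sq_nonneg x)]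

lemma xm_bd {ε : ℝ} (hε : 0 ≤ ε) (m : ℕ) : ((m:ℝ)+1)^(-(1+ε)) ≤ ((m:ℝ)+1)⁻¹ := by
  rw [← Real.rpow_neg_one]
  exact Real.rpow_le_rpow_of_exponent_le (by linarith [Nat.cast_nonneg (α := ℝ) m]) (by linarith)

lemma xm_half {ε : ℝ} (hε : 0 ≤ ε) {m : ℕ} (hm : (m+1).Prime) : ((m:ℝ)+1)^(-(1+ε)) ≤ 1/2 := by
  refine (xm_bd hε m).trans ?_
  rw [one_div]
  have := hm.two_le
  have : (2:ℝ) ≤ m + 1 := by exact_mod_cast this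
  exact inv_anti₀ (by norm_num) this

noncomputable def WW (n : ℕ) : ℝ := ((9:ℝ)^n + 27^n)^2 + 2 * aa n

lemma wn_leR (n p : ℕ) : (wn n p : ℝ) ≤ 9^n + 27^n := by exact_mod_cast wn_le n p

lemma rr_bound (n : ℕ) {ε : ℝ} (hε : 0 ≤ ε) (m : ℕ) : ‖rr n ε m‖ ≤ WW n * (((m:ℝ)+1)^2)⁻¹ := by
  rw [rr, gg, thm]
  have hW : 0 ≤ WW n := by unfold WW; positivity
  split_ifs with hp
  · rw [Real.norm_eq_abs]
    refine (log_est (Nat.cast_nonneg _) (Nat.cast_nonneg _) (by positivity) (xm_half hε hp)).trans ?_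
    have h1 : (wn n (m+1) : ℝ)^2 ≤ ((9:ℝ)^n + 27^n)^2 := pow_le_pow_left₀ (Nat.cast_nonneg _) (wn_leR _ _) 2
    have h2 : (((m:ℝ)+1)^(-(1+ε)))^2 ≤ (((m:ℝ)+1)^2)⁻¹ := by
      rw [← inv_pow]; exact pow_le_pow_left₀ (by positivity) (xm_bd hε m) 2
    refine mul_le_mul ?_ h2 (by positivity) hW
    unfold WW; linarith
  · simp; positivity

lemma summable_inv_sq : Summable fun m : ℕ => (((m:ℝ)+1)^2)⁻¹ := by
  have := (summable_nat_add_iff (f := fun m : ℕ => ((m:ℝ)^2)⁻¹) 1).2 (Real.summable_nat_pow_inv.2 (by norm_num))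
  simpa using this

lemma rr_summable (n : ℕ) {ε : ℝ} (hε : 0 ≤ ε) : Summable (rr n ε) :=
  Summable.of_norm_bounded (summable_inv_sq.mul_left _) (rr_bound n hε)

lemma rr_tendsto (n : ℕ) : Tendsto (fun ε => ∑' m, rr n ε m) (𝓝[>] 0) (𝓝 (∑' m, rr n 0 m)) := by
  refine tendsto_tsum_of_dominated_convergence (summable_inv_sq.mul_left (WW n)) ?_ ?_
  · intro m
    have hx : Tendsto (fun ε : ℝ => ((m:ℝ)+1)^(-(1+ε))) (𝓝[>] 0) (𝓝 (((m:ℝ)+1)^(-(1+0:ℝ)))) := by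
      refine tendsto_nhdsWithin_of_tendsto_nhds ?_
      have : Continuous fun ε : ℝ => ((m:ℝ)+1)^(-(1+ε)) := by
        refine Continuous.rpow continuous_const (by fun_prop) fun x => Or.inl (by positivity)
      exact this.tendsto 0
    unfold rr gg
    split_ifs with hp
    · refine ((Tendsto.log (tendsto_const_nhds.add (hx.const_mul _)) ?_).add ((Tendsto.log (tendsto_const_nhds.sub hx) ?_).const_mul _)).sub (hx.const_mul _)
      · positivity
      · have := xm_half (ε := 0) le_rfl hp
        intro h'
        rw [sub_eq_zero] at h'
        rw [← h'] at this
        norm_num at this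
    · exact tendsto_const_nhds.sub (hx.const_mul _)
  · filter_upwards [self_mem_nhdsWithin] with ε hε m
    exact rr_bound n (le_of_lt hε) m

lemma thm_abs (n m : ℕ) : |thm n m| ≤ 9^n + 27^n + aa n := by
  rw [thm]
  split_ifs
  · have := wn_leR n (m+1)
    have h0 : (0:ℝ) ≤ wn n (m+1) := Nat.cast_nonneg _
    have h1 : (0:ℝ) ≤ aa n := Nat.cast_nonneg _
    have h2 : (0:ℝ) ≤ 9^n + 27^n := by positivity
    rw [abs_le]; constructor <;> linarith
  · simp; positivity

lemma thm_summable (n : ℕ) {ε : ℝ} (hε : 0 < ε) : Summable fun m => thm n m * ((m:ℝ)+1)^(-(1+ε)) := by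
  have h1 : Summable fun m : ℕ => ((m:ℝ)+1)^(-(1+ε)) := by
    have := (summable_nat_add_iff (f := fun m : ℕ => (m:ℝ)^(-(1+ε))) 1).2 (Real.summable_nat_rpow.2 (by linarith))
    simpa using this
  refine Summable.of_norm_bounded (h1.mul_left ((9:ℝ)^n + 27^n + aa n)) fun m => ?_
  rw [norm_mul, Real.norm_of_nonneg (show (0:ℝ) ≤ ((m:ℝ)+1)^(-(1+ε)) by positivity)]
  exact mul_le_mul_of_nonneg_right (thm_abs n m) (by positivity)

lemma exp_gg (n : ℕ) {ε : ℝ} (hε : 0 ≤ ε) (N : ℕ) : 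
    ∏ p ∈ Nat.primesBelow (N+1), (1 + wn n p * (p:ℝ)^(-(1+ε))) * (1 - (p:ℝ)^(-(1+ε)))^(aa n) = 
    Real.exp (∑ m ∈ Finset.range N, gg n ε m) := by
  rw [primesBelow_prod, Real.exp_sum]
  refine Finset.prod_congr rfl fun m _ => ?_
  rw [gg]
  split_ifs with hp
  · have := xm_half hε hp
    rw [Real.exp_add, Real.exp_log (by positivity), Real.exp_nat_mul, Real.exp_log (by linarith)]
    simp
  · simp

/-- The Euler product constant. -/
lemma euler_final (n : ℕ) {l : ℂ}
    (hl : Tendsto (fun N : ℕ => ∑ m ∈ Finset.range N, bA n (m+1)/((m:ℂ)+1)) atTop (𝓝 l)) :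
    ∃ c : ℝ, 0 < c ∧ l = c ∧ Tendsto (fun N : ℕ => ∏ p ∈ Nat.primesBelow (N+1), (1 + wn n p / (p:ℝ)) * (1 - 1/(p:ℝ))^(aa n)) atTop (𝓝 c) := by
  obtain ⟨t, ht⟩ := thm_converges n
  -- t is real
  have htre : Tendsto (fun N : ℕ => ∑ m ∈ Finset.range N, (thm n m / ((m:ℝ)+1))) atTop (𝓝 t.re) := by
    have := (Complex.continuous_re.tendsto t).comp ht
    refine this.congr fun N => ?_
    simp only [Function.comp]
    rw [← Complex.ofReal_sum, Complex.ofReal_re]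
  have htc : (t.re : ℂ) = t := by
    refine tendsto_nhds_unique ?_ ht
    refine ((Complex.continuous_ofReal.tendsto _).comp htre).congr fun N => ?_
    simp
  have hF : Tendsto (fun ε : ℝ => ∑' m, thm n m * ((m:ℝ)+1)^(-(1+ε))) (𝓝[>] 0) (𝓝 t.re) := by
    have := abel_dirichlet (fun m => ((thm n m / ((m:ℝ)+1) : ℝ) : ℂ)) t
      (fun ε => ((∑' m, thm n m * ((m:ℝ)+1)^(-(1+ε)) : ℝ) : ℂ)) ht ?_
    · have := (Complex.continuous_re.tendsto t).comp this
      exact this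
    · intro ε hε
      refine ((Complex.continuous_ofReal.tendsto _).comp (thm_summable n hε).hasSum.tendsto_sum_nat).congr fun N => ?_
      simp only [Function.comp]
      rw [Complex.ofReal_sum]
      refine Finset.sum_congr rfl fun m _ => ?_
      rw [← Complex.ofReal_mul]
      congr 1
      rw [neg_add, Real.rpow_add (by positivity), Real.rpow_neg_one]
      ring
  refine ⟨Real.exp (t.re + ∑' m, rr n 0 m), Real.exp_pos _, ?_, ?_⟩
  · have h1 := (bA_PS n).tendsto_LSeries hl
    have h2 : ∀ ε : ℝ, 0 < ε → LSeries (fun m => bA n m) ((1+ε:ℝ):ℂ) = 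
        ((Real.exp (∑' m, thm n m * ((m:ℝ)+1)^(-(1+ε)) + ∑' m, rr n ε m) : ℝ) : ℂ) := by
      intro ε hε
      have h3 := (bA_euler n (σ := 1+ε) (by linarith)).comp (tendsto_add_atTop_nat 1)
      refine tendsto_nhds_unique h3 ?_
      have h4 := ((thm_summable n hε).hasSum.add (rr_summable n hε.le).hasSum).tendsto_sum_nat
      refine ((Complex.continuous_ofReal.tendsto _).comp ((Real.continuous_exp.tendsto _).comp h4)).congr fun N => ?_
      simp only [Function.comp]
      rw [← Complex.ofReal_prod, exp_gg n hε.le]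
      congr 3
      funext m
      rw [rr]; ring
    have h5 : Tendsto (fun ε : ℝ => LSeries (fun m => bA n m) ((1+ε:ℝ):ℂ)) (𝓝[>] 0) (𝓝 ((Real.exp (t.re + ∑' m, rr n 0 m) : ℝ) : ℂ)) := by
      refine ((Complex.continuous_ofReal.tendsto _).comp ((Real.continuous_exp.tendsto _).comp (hF.add (rr_tendsto n)))).congr' ?_
      filter_upwards [self_mem_nhdsWithin] with ε hε
      rw [h2 ε hε]; rfl
    exact tendsto_nhds_unique h1 h5
  · have h4 := htre.add (rr_summable n le_rfl).hasSum.tendsto_sum_nat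
    refine ((Real.continuous_exp.tendsto _).comp h4).congr fun N => ?_
    simp only [Function.comp]
    have := exp_gg n le_rfl N
    rw [← Finset.sum_add_distrib]
    have h6 : ∀ m, thm n m / ((m:ℝ)+1) + rr n 0 m = gg n 0 m := by
      intro m
      rw [rr, add_zero, Real.rpow_neg_one]; ring
    simp only [h6, ← this]
    refine Finset.prod_congr rfl fun p _ => ?_
    rw [add_zero, Real.rpow_neg_one, div_eq_mul_inv, one_div]

end

section
lemma tuple_count {I : Type*} [Fintype I] [DecidableEq I] (A : ℕ → Finset I) (N : ℕ) (hN : N ≠ 0) :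
    Finite {v : I → ℕ // (∀ g, Squarefree (v g)) ∧ (∀ g h, g ≠ h → Nat.Coprime (v g) (v h)) ∧
      (∀ g p, p.Prime → p ∣ v g → g ∈ A p) ∧ ∏ g, v g = N} ∧
    Nat.card {v : I → ℕ // (∀ g, Squarefree (v g)) ∧ (∀ g h, g ≠ h → Nat.Coprime (v g) (v h)) ∧
      (∀ g p, p.Prime → p ∣ v g → g ∈ A p) ∧ ∏ g, v g = N} =
      if Squarefree N then ∏ p ∈ N.primeFactors, (A p).card else 0 := by
  by_cases hsq : Squarefree N
  swap
  · have : IsEmpty {v : I → ℕ // (∀ g, Squarefree (v g)) ∧ (∀ g h, g ≠ h → Nat.Coprime (v g) (v h)) ∧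
      (∀ g p, p.Prime → p ∣ v g → g ∈ A p) ∧ ∏ g, v g = N} := by
      refine ⟨fun v => hsq ?_⟩
      obtain ⟨v, h1, h2, -, h4⟩ := v
      rw [← h4]
      refine Finset.squarefree_prod_of_pairwise_isCoprime ?_ (fun g _ => h1 g)
      intro g _ h _ hgh
      exact Nat.coprime_iff_isRelPrime.1 (h2 g h hgh)
    rw [if_neg hsq]
    exact ⟨inferInstance, Nat.card_of_isEmpty⟩
  rw [if_pos hsq]
  let F : ((p : N.primeFactors) → A p) → I → ℕ := fun φ g => ∏ p : N.primeFactors, if (φ p : I) = g then (p:ℕ) else 1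
  have hF : ∀ φ g (q : N.primeFactors), (q:ℕ) ∣ F φ g ↔ (φ q : I) = g := by
    intro φ g q
    have hq : (q:ℕ).Prime := Nat.prime_of_mem_primeFactors q.2
    constructor
    · intro h
      obtain ⟨p, -, hp⟩ := (hq.prime.dvd_finsetProd_iff _).1 h
      split_ifs at hp with h2
      · have : q = p := Subtype.ext ((Nat.prime_dvd_prime_iff_eq hq (Nat.prime_of_mem_primeFactors p.2)).1 hp)
        rw [this]; exact h2
      · exact absurd (Nat.dvd_one.1 hp) hq.one_lt.ne'
    · intro h
      have := Finset.dvd_prod_of_mem (fun p : N.primeFactors => if (φ p : I) = g then (p:ℕ) else 1) (Finset.mem_univ q)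
      simpa [h, F] using this
  have hprod : ∀ φ, ∏ g, F φ g = N := by
    intro φ
    simp only [F]
    rw [Finset.prod_comm]
    simp only [Finset.prod_ite_eq, Finset.mem_univ, if_true]
    rw [Finset.prod_coe_sort N.primeFactors (fun p => p)]
    exact Nat.prod_primeFactors_of_squarefree hsq
  have hdvd : ∀ φ g, F φ g ∣ N := fun φ g => by
    rw [← hprod φ]; exact Finset.dvd_prod_of_mem _ (Finset.mem_univ g)
  let E : ((p : N.primeFactors) → A p) → {v : I → ℕ // (∀ g, Squarefree (v g)) ∧ (∀ g h, g ≠ h → Nat.Coprime (v g) (v h)) ∧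
      (∀ g p, p.Prime → p ∣ v g → g ∈ A p) ∧ ∏ g, v g = N} := fun φ => ⟨F φ, by
    refine ⟨fun g => hsq.squarefree_of_dvd (hdvd φ g), ?_, ?_, hprod φ⟩
    · intro g h hgh
      refine Nat.coprime_of_dvd fun q hq h1 h2 => hgh ?_
      have hqm : q ∈ N.primeFactors := Nat.mem_primeFactors.2 ⟨hq, h1.trans (hdvd φ g), hN⟩
      rw [← (hF φ g ⟨q, hqm⟩).1 h1, (hF φ h ⟨q, hqm⟩).1 h2]
    · intro g q hq h1
      have hqm : q ∈ N.primeFactors := Nat.mem_primeFactors.2 ⟨hq, h1.trans (hdvd φ g), hN⟩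
      rw [← (hF φ g ⟨q, hqm⟩).1 h1]
      exact (φ ⟨q, hqm⟩).2⟩
  have hE : Function.Bijective E := by
    constructor
    · intro φ φ' h
      have h' : F φ = F φ' := congrArg Subtype.val h
      funext q
      have := (hF φ (φ q) q).2 rfl
      rw [h'] at this
      exact Subtype.ext ((hF φ' (φ q) q).1 this).symm
    · rintro ⟨v, h1, h2, h3, h4⟩
      have hex : ∀ q : N.primeFactors, ∃ g, (q:ℕ) ∣ v g := by
        intro q
        have hq : (q:ℕ).Prime := Nat.prime_of_mem_primeFactors q.2
        have hd : (q:ℕ) ∣ ∏ g, v g := (Nat.dvd_of_mem_primeFactors q.2).trans h4.symm.dvd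
        obtain ⟨g, -, hg⟩ := (hq.prime.dvd_finsetProd_iff _).1 hd
        exact ⟨g, hg⟩
      choose f hf using hex
      refine ⟨fun q => ⟨f q, h3 _ _ (Nat.prime_of_mem_primeFactors q.2) (hf q)⟩, Subtype.ext ?_⟩
      funext g
      show ∏ p : N.primeFactors, (if f p = g then (p:ℕ) else 1) = v g
      have hiff : ∀ p : N.primeFactors, f p = g ↔ (p:ℕ) ∣ v g := by
        intro p
        have hp : (p:ℕ).Prime := Nat.prime_of_mem_primeFactors p.2
        constructor
        · rintro rfl; exact hf p
        · intro h
          by_contra hne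
          exact hp.one_lt.ne' (Nat.eq_one_of_dvd_coprimes (h2 _ _ hne) (hf p) h)
      simp only [hiff]
      rw [Finset.prod_coe_sort N.primeFactors (fun p => if p ∣ v g then p else 1), ← Finset.prod_filter]
      rw [← Nat.prod_primeFactors_of_squarefree (h1 g)]
      refine Finset.prod_congr ?_ fun _ _ => rfl
      ext p
      have hvN : v g ∣ N := by rw [← h4]; exact Finset.dvd_prod_of_mem _ (Finset.mem_univ g)
      rw [Nat.prod_primeFactors_of_squarefree (h1 g)]
      simp only [Finset.mem_filter, Nat.mem_primeFactors]
      constructor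
      · rintro ⟨⟨a, b, c⟩, d⟩; exact ⟨a, d, (h1 g).ne_zero⟩
      · rintro ⟨a, b, c⟩; exact ⟨⟨a, b.trans hvN, hN⟩, b⟩
  refine ⟨Finite.of_surjective E hE.2, ?_⟩
  rw [← Nat.card_eq_of_bijective E hE, Nat.card_pi]
  simp only [Nat.card_eq_fintype_card, Fintype.card_coe]
  exact Finset.prod_coe_sort N.primeFactors (fun p => (A p).card)

end

section
namespace Gn
variable {n : ℕ}

lemma pow_K (g : Gn n) (hg : pi0 (qn g) = 0) (k : ℕ) : g ^ k = ((k • g.1, ((0 : ZMod 3), k • g.2.2)) : (Fin n → ZMod 3) × An n) := by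
  induction k with
  | zero => 
    rw [pow_zero, zero_smul, zero_smul]; rfl
  | succ k ih =>
    rw [pow_succ, ih]
    have h0 : g.2.1 = 0 := hg
    apply Prod.ext
    · show k • g.1 + g.1 + theta ((0 : ZMod 3), k • g.2.2) g.2 = (k+1) • g.1
      have : theta ((0 : ZMod 3), k • g.2.2) g.2 = 0 := by
        funext i; simp [theta, pi0]
      rw [this, add_zero, succ_nsmul]
    · apply Prod.ext
      · show (0 : ZMod 3) + g.2.1 = 0
        rw [h0, add_zero]
      · show k • g.2.2 + g.2.2 = (k+1) • g.2.2
        rw [succ_nsmul]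

lemma pow_K_eq_one (g : Gn n) (hg : pi0 (qn g) = 0) (k : ℕ) : g ^ k = 1 ↔ ∀ i, (k : ZMod 3) * g.1 i = 0 ∧ (k : ZMod 9) * g.2.2 i = 0 := by
  rw [pow_K g hg]
  constructor
  · intro h i
    have h1 : k • g.1 = 0 := congrArg Prod.fst h
    have h2 : k • g.2.2 = 0 := congrArg (fun x => x.2.2) h
    have h1 := congrFun h1 i
    have h2 := congrFun h2 i
    simp only [Pi.smul_apply, nsmul_eq_mul, Pi.zero_apply] at h1 h2
    exact ⟨h1, h2⟩
  · intro h
    apply Prod.ext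
    · show k • g.1 = 0
      funext i; simpa using (h i).1
    · apply Prod.ext
      · rfl
      · show k • g.2.2 = 0
        funext i; simpa using (h i).2

def Keq (k : ℕ) : {g : Gn n // pi0 (qn g) = 0 ∧ g ^ k = 1} ≃ (Fin n → {x : ZMod 3 × ZMod 9 // (k : ZMod 3) * x.1 = 0 ∧ (k : ZMod 9) * x.2 = 0}) where
  toFun g := fun i => ⟨(g.1.1 i, g.1.2.2 i), (pow_K_eq_one g.1 g.2.1 k).1 g.2.2 i⟩
  invFun f := ⟨((fun i => (f i).1.1), ((0 : ZMod 3), fun i => (f i).1.2)), rfl, (pow_K_eq_one _ rfl k).2 fun i => (f i).2⟩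
  left_inv g := by
    apply Subtype.ext
    have h0 : g.1.2.1 = 0 := g.2.1
    apply Prod.ext
    · rfl
    · apply Prod.ext
      · exact h0.symm
      · rfl
  right_inv f := rfl

lemma K_card1 (p : ℕ) (hp : 1 ≤ p) : Nat.card {x : ZMod 3 × ZMod 9 // ((p - 1 : ℕ) : ZMod 3) * x.1 = 0 ∧ ((p - 1 : ℕ) : ZMod 9) * x.2 = 0} =
    if p % 9 = 4 ∨ p % 9 = 7 then 9 else if p % 9 = 1 then 27 else 1 := by
  have h9 : ((p - 1 : ℕ) : ZMod 9) = (((p+8) % 9 : ℕ) : ZMod 9) := by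
    rw [ZMod.natCast_eq_natCast_iff]; show (p-1) % 9 = ((p+8)%9)%9; omega
  have h3 : ((p - 1 : ℕ) : ZMod 3) = (((p+8) % 9 : ℕ) : ZMod 3) := by
    rw [ZMod.natCast_eq_natCast_iff]; show (p-1) % 3 = ((p+8)%9)%3; omega
  rw [h9, h3]
  have h : p % 9 < 9 := Nat.mod_lt _ (by norm_num)
  have h' : (p+8)%9 = (p%9+8)%9 := by omega
  rw [h', Nat.card_eq_fintype_card]
  generalize p % 9 = r at h
  interval_cases r <;> decide

lemma K_card (p : ℕ) (hp : 1 ≤ p) : Nat.card {g : Gn n // pi0 (qn g) = 0 ∧ g ^ (p-1) = 1} = wn n p + 1 := by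
  rw [Nat.card_congr (Keq (p-1)), Nat.card_fun, K_card1 p hp, wn, Nat.card_eq_fintype_card, Fintype.card_fin]
  have h1 : 1 ≤ 9^n := Nat.one_le_pow _ _ (by norm_num)
  have h2 : 1 ≤ 27^n := Nat.one_le_pow _ _ (by norm_num)
  split_ifs
  · omega
  · omega
  · simp

lemma modEq_iff (g : Gn n) (p : ℕ) (hp : 1 ≤ p) : p ≡ 1 [MOD orderOf g] ↔ g^(p-1) = 1 := by
  rw [← orderOf_dvd_iff_pow_eq_one]
  constructor
  · intro h; exact (Nat.modEq_iff_dvd' hp).1 h.symm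
  · intro h; exact ((Nat.modEq_iff_dvd' hp).2 h).symm

lemma B_card : Nat.card {g : Gn n // pi0 (qn g) ≠ 0} = 2 * 27^n := by
  have e : {g : Gn n // pi0 (qn g) ≠ 0} ≃ (Fin n → ZMod 3) × ({x : ZMod 3 // x ≠ 0} × (Fin n → ZMod 9)) :=
    { toFun := fun g => (g.1.1, (⟨g.1.2.1, g.2⟩, g.1.2.2))
      invFun := fun x => ⟨(x.1, (x.2.1.1, x.2.2)), x.2.1.2⟩
      left_inv := fun _ => rfl
      right_inv := fun _ => rfl }
  rw [Nat.card_congr e, Nat.card_prod, Nat.card_prod, Nat.card_fun, Nat.card_fun]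
  have : Nat.card {x : ZMod 3 // x ≠ 0} = 2 := by rw [Nat.card_eq_fintype_card]; decide
  rw [this]
  simp only [Nat.card_eq_fintype_card, ZMod.card, Fintype.card_fin]
  rw [show 27 = 3 * 9 by norm_num, mul_pow]; ring

/-- Allowed indices for the prime `p`. -/
def AA (n : ℕ) (p : ℕ) : Finset {g : Gn n // g ≠ 1} :=
  Finset.univ.filter fun g => (pi0 (qn g.1) ≠ 0 ∧ p = 3) ∨ (pi0 (qn g.1) = 0 ∧ g.1 ^ (p-1) = 1)

lemma K3 (g : Gn n) (hg : pi0 (qn g) = 0) (h : g^(3-1) = 1) : g = 1 := by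
  have h2 := (pow_K_eq_one g hg 2).1 h
  have h1 := (pow_K_eq_one g hg 1).2 fun i => by
    obtain ⟨a, b⟩ := h2 i
    revert a b
    generalize g.1 i = x
    generalize g.2.2 i = y
    revert x y
    decide
  simpa using h1

lemma AA_card3 : (AA n 3).card = 2 * 27^n := by
  rw [← B_card, ← Fintype.card_coe, ← Nat.card_eq_fintype_card]
  refine Nat.card_congr
    { toFun := fun g => ⟨g.1.1, ?_⟩
      invFun := fun g => ⟨⟨g.1, ?_⟩, ?_⟩
      left_inv := fun _ => rfl
      right_inv := fun _ => rfl }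
  · have := g.2
    simp only [AA, Finset.mem_filter, Finset.mem_univ, true_and] at this
    rcases this with h | h
    · exact h.1
    · exact absurd (K3 _ h.1 h.2) g.1.2
  · intro h
    apply g.2; rw [h]; rfl
  · simp only [AA, Finset.mem_filter, Finset.mem_univ, true_and]
    exact Or.inl ⟨g.2, trivial⟩

lemma AA_card (p : ℕ) (hp : 1 ≤ p) (h3 : p ≠ 3) : (AA n p).card = wn n p := by
  have h := K_card (n := n) p hp
  have e : Option (AA n p) ≃ {g : Gn n // pi0 (qn g) = 0 ∧ g ^ (p-1) = 1} := by
    refine Equiv.ofBijective (fun o => o.elim ⟨1, rfl, one_pow _⟩ fun g => ⟨g.1.1, ?_⟩) ⟨?_, ?_⟩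
    · have := g.2
      simp only [AA, Finset.mem_filter, Finset.mem_univ, true_and] at this
      rcases this with h | h
      · exact absurd h.2 h3
      · exact h
    · rintro (_ | a) (_ | b) hab
      · rfl
      · exact absurd (congrArg Subtype.val hab).symm b.1.2
      · exact absurd (congrArg Subtype.val hab) a.1.2
      · have := congrArg Subtype.val hab
        congr 1
        exact Subtype.ext (Subtype.ext this)
    · rintro ⟨g, h1, h2⟩
      by_cases hg : g = 1
      · subst hg; exact ⟨none, rfl⟩
      · refine ⟨some ⟨⟨g, hg⟩, ?_⟩, rfl⟩
        simp only [AA, Finset.mem_filter, Finset.mem_univ, true_and]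
        exact Or.inr ⟨h1, h2⟩
  rw [← Nat.card_congr e, Nat.card_eq_fintype_card, Fintype.card_option, Fintype.card_coe] at h
  omega

end Gn

lemma count3 (n m : ℕ) (hm : m ≠ 0) : (if Squarefree (3*m) then ∏ p ∈ (3*m).primeFactors, (Gn.AA n p).card else 0) = 2 * 27^n * fn n m := by
  have hp3 : Nat.Prime 3 := Nat.prime_three
  by_cases h3 : 3 ∣ m
  · have h1 : ¬ Squarefree (3*m) := by
      intro h
      have := h 3 (Nat.mul_dvd_mul_left 3 h3)
      simp at this
    have h2 : fn n m = 0 := by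
      rw [fn]; split_ifs
      · exact Finset.prod_eq_zero (Nat.mem_primeFactors.2 ⟨hp3, h3, hm⟩) (by simp [wn])
      · rfl
    rw [if_neg h1, h2, mul_zero]
  · have hc : Nat.Coprime 3 m := (hp3.coprime_iff_not_dvd).2 h3
    rw [fn]
    have hs3 : Squarefree 3 := hp3.squarefree
    by_cases hs : Squarefree m
    · rw [if_pos (Nat.squarefree_mul_iff.2 ⟨hc, hs3, hs⟩), if_pos hs, hc.primeFactors_mul, hp3.primeFactors, Finset.prod_union, Finset.prod_singleton, Gn.AA_card3]
      · congr 1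
        refine Finset.prod_congr rfl fun p hp => ?_
        have hp' := Nat.mem_primeFactors.1 hp
        refine Gn.AA_card p hp'.1.one_lt.le ?_
        rintro rfl
        exact h3 hp'.2.1
      · simp [h3]
    · rw [if_neg (fun h => hs (Nat.squarefree_mul_iff.1 h).2.2), if_neg hs, mul_zero]

lemma bad_iff (n : ℕ) (X : ℝ) (v : {g : Gn n // g ≠ 1} → ℕ) :
    ((∀ g, 0 < v g ∧ Squarefree (v g)) ∧
    (∀ g h : {g : Gn n // g ≠ 1}, g ≠ h → Nat.Coprime (v g) (v h)) ∧
    (∀ g : {g : Gn n // g ≠ 1}, pi0 (Gn.qn g.1) = 0 →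
      ∀ p, p.Prime → p ∣ v g → p ≡ 1 [MOD orderOf g.1]) ∧
    (∏ g ∈ Finset.univ.filter
        (fun g : {g : Gn n // g ≠ 1} => pi0 (Gn.qn g.1) ≠ 0), v g) = 3 ∧
    ((∏ g, v g : ℕ) : ℝ) ≤ X) ↔
    ∃ m ∈ Finset.Ioc 0 ⌊X/3⌋₊, (∀ g, Squarefree (v g)) ∧ (∀ g h, g ≠ h → Nat.Coprime (v g) (v h)) ∧
      (∀ g p, p.Prime → p ∣ v g → g ∈ Gn.AA n p) ∧ ∏ g, v g = 3 * m := by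
  constructor
  · rintro ⟨h1, h2, h3, h4, h5⟩
    have hsplit := Finset.prod_filter_mul_prod_filter_not Finset.univ (fun g : {g : Gn n // g ≠ 1} => pi0 (Gn.qn g.1) ≠ 0) v
    rw [h4] at hsplit
    have hpos : 0 < ∏ g ∈ Finset.univ.filter (fun g : {g : Gn n // g ≠ 1} => ¬ pi0 (Gn.qn g.1) ≠ 0), v g :=
      Finset.prod_pos fun g _ => (h1 g).1
    refine ⟨∏ g ∈ Finset.univ.filter (fun g : {g : Gn n // g ≠ 1} => ¬ pi0 (Gn.qn g.1) ≠ 0), v g, ?_, fun g => (h1 g).2, h2, ?_, hsplit.symm⟩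
    · rw [Finset.mem_Ioc]
      refine ⟨hpos, Nat.le_floor ?_⟩
      rw [← hsplit, Nat.cast_mul] at h5
      push_cast at h5 ⊢
      linarith
    · intro g p hp hpg
      simp only [Gn.AA, Finset.mem_filter, Finset.mem_univ, true_and]
      by_cases hg : pi0 (Gn.qn g.1) = 0
      · exact Or.inr ⟨hg, (Gn.modEq_iff _ _ hp.one_lt.le).1 (h3 g hg p hp hpg)⟩
      · refine Or.inl ⟨hg, ?_⟩
        have : p ∣ 3 := by
          rw [← h4]
          exact hpg.trans (Finset.dvd_prod_of_mem _ (by simp [hg]))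
        exact (Nat.prime_dvd_prime_iff_eq hp Nat.prime_three).1 this
  · rintro ⟨m, hm, h1, h2, h3, h4⟩
    rw [Finset.mem_Ioc] at hm
    refine ⟨fun g => ⟨Nat.pos_of_ne_zero (h1 g).ne_zero, h1 g⟩, h2, ?_, ?_, ?_⟩
    · intro g hg p hp hpg
      have := h3 g p hp hpg
      simp only [Gn.AA, Finset.mem_filter, Finset.mem_univ, true_and] at this
      rcases this with h | h
      · exact absurd hg h.1
      · exact (Gn.modEq_iff _ _ hp.one_lt.le).2 h.2
    · set D := ∏ g ∈ Finset.univ.filter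
        (fun g : {g : Gn n // g ≠ 1} => pi0 (Gn.qn g.1) ≠ 0), v g with hD
      have hsqD : Squarefree D := by
        refine Finset.squarefree_prod_of_pairwise_isCoprime ?_ (fun g _ => h1 g)
        intro g _ h _ hgh
        exact Nat.coprime_iff_isRelPrime.1 (h2 g h hgh)
      have h3D : 3 ∣ D := by
        have : 3 ∣ ∏ g, v g := by rw [h4]; exact dvd_mul_right _ _
        obtain ⟨g, -, hg⟩ := (Nat.prime_three.prime.dvd_finsetProd_iff _).1 this
        refine hg.trans (Finset.dvd_prod_of_mem _ ?_)
        have := h3 g 3 Nat.prime_three hg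
        simp only [Gn.AA, Finset.mem_filter, Finset.mem_univ, true_and] at this ⊢
        rcases this with h | h
        · exact h.1
        · exact absurd (Gn.K3 _ h.1 h.2) g.2
      have hpf : D.primeFactors = {3} := by
        ext p
        rw [Nat.mem_primeFactors, Finset.mem_singleton]
        constructor
        · rintro ⟨hp, hpD, -⟩
          obtain ⟨g, hgm, hg⟩ := (hp.prime.dvd_finsetProd_iff _).1 hpD
          have := h3 g p hp hg
          simp only [Gn.AA, Finset.mem_filter, Finset.mem_univ, true_and] at this hgm
          rcases this with h | h
          · exact h.2
          · exact absurd h.1 hgm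
        · rintro rfl; exact ⟨Nat.prime_three, h3D, hsqD.ne_zero⟩
      rw [← Nat.prod_primeFactors_of_squarefree hsqD, hpf, Finset.prod_singleton]
    · rw [h4]
      have := (Nat.le_floor_iff' hm.1.ne').1 hm.2
      push_cast
      linarith

lemma badCount_eq (n : ℕ) (X : ℝ) : badCount n X = 2 * 27^n * ∑ m ∈ Finset.Ioc 0 ⌊X/3⌋₊, fn n m := by
  rw [badCount, Nat.card_congr (Equiv.subtypeEquivRight (bad_iff n X))]
  let S : ℕ → Type := fun m => {v : {g : Gn n // g ≠ 1} → ℕ // (∀ g, Squarefree (v g)) ∧ (∀ g h, g ≠ h → Nat.Coprime (v g) (v h)) ∧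
      (∀ g p, p.Prime → p ∣ v g → g ∈ Gn.AA n p) ∧ ∏ g, v g = 3 * m}
  have hS : ∀ m : Finset.Ioc 0 ⌊X/3⌋₊, Finite (S m) ∧ Nat.card (S m) = 2 * 27^n * fn n m := by
    intro m
    have hm := m.2
    rw [Finset.mem_Ioc] at hm
    have := tuple_count (Gn.AA n) (3*(m:ℕ)) (by omega)
    exact ⟨this.1, by rw [← count3 n m (by omega)]; exact this.2⟩
  have : ∀ m : Finset.Ioc 0 ⌊X/3⌋₊, Finite (S m) := fun m => (hS m).1
  have key : Nat.card (Σ m : Finset.Ioc 0 ⌊X/3⌋₊, S m) = 2 * 27^n * ∑ m ∈ Finset.Ioc 0 ⌊X/3⌋₊, fn n m := by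
    rw [Nat.card_sigma, Finset.mul_sum, ← Finset.sum_coe_sort (Finset.Ioc 0 ⌊X/3⌋₊) (fun m => 2 * 27^n * fn n m)]
    exact Finset.sum_congr rfl fun m _ => (hS m).2
  rw [← key]
  symm
  refine Nat.card_eq_of_bijective (fun x => ⟨x.2.1, x.1.1, x.1.2, x.2.2⟩) ⟨?_, ?_⟩
  · rintro ⟨⟨m, hm⟩, v, hv⟩ ⟨⟨m', hm'⟩, v', hv'⟩ h
    have hvv : v = v' := congrArg Subtype.val h
    subst hvv
    have : m = m' := by
      have := hv.2.2.2.symm.trans hv'.2.2.2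
      simp only at this
      omega
    subst this
    rfl
  · rintro ⟨v, m, hm, hv⟩
    exact ⟨⟨⟨m, hm⟩, v, hv⟩, rfl⟩

end

section
open Filter Topology ArithmeticFunction
open scoped ArithmeticFunction.Moebius ArithmeticFunction.zeta

lemma log_ratio (k : ℕ) : Tendsto (fun X : ℝ => (Real.log (X/3) / Real.log X)^k) atTop (𝓝 1) := by
  have h1 : Tendsto (fun X : ℝ => 1 - Real.log 3 / Real.log X) atTop (𝓝 (1 - 0)) :=
    tendsto_const_nhds.sub (Real.tendsto_log_atTop.const_div_atTop _)
  have h2 : Tendsto (fun X : ℝ => Real.log (X/3) / Real.log X) atTop (𝓝 1) := by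
    rw [sub_zero] at h1
    refine h1.congr' ?_
    filter_upwards [eventually_gt_atTop 1] with X hX
    have := Real.log_pos hX
    rw [Real.log_div (by linarith) (by norm_num)]
    field_simp
  simpa using h2.pow k

lemma main_asym (n : ℕ) (hn : 1 ≤ n) {c : ℝ} (hc : 0 < c)
    (hl : Tendsto (fun N : ℕ => ∑ m ∈ Finset.range N, bA n (m+1)/((m:ℂ)+1)) atTop (𝓝 (c:ℂ))) :
    Tendsto (fun X : ℝ => (badCount n X : ℝ) /
      (2 * 27 ^ n * c * X * Real.log X ^ ((aa n : ℝ) - 1) / (3 * Real.Gamma (aa n : ℝ)))) atTop (𝓝 1) := by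
  obtain ⟨k, hk⟩ : ∃ k, aa n = k + 1 := ⟨aa n - 1, by have := aa_pos n hn; omega⟩
  have h1 := (bA_PS n).asym hl k
  rw [← hk, bA_mul_zeta] at h1
  have h2 : Tendsto (fun x : ℝ => (∑ m ∈ Finset.Ioc 0 ⌊x⌋₊, (fn n m : ℝ)) / (x * Real.log x ^ k)) atTop (𝓝 (c / k.factorial)) := by
    have := (Complex.continuous_re.tendsto _).comp h1
    have hre : (((c:ℂ) / (k.factorial : ℂ))).re = c / k.factorial := by
      rw [← Complex.ofReal_natCast, ← Complex.ofReal_div, Complex.ofReal_re]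
    rw [hre] at this
    refine this.congr fun x => ?_
    simp only [Function.comp, fA_apply]
    have : (∑ m ∈ Finset.Ioc 0 ⌊x⌋₊, (fn n m : ℂ)) = ((∑ m ∈ Finset.Ioc 0 ⌊x⌋₊, (fn n m : ℝ) : ℝ) : ℂ) := by push_cast; rfl
    rw [this, ← Complex.ofReal_div, Complex.ofReal_re]
  have h3 := h2.comp (tendsto_id.atTop_div_const (show (0:ℝ) < 3 by norm_num))
  have h4 := (h3.mul (log_ratio k)).mul_const ((k.factorial : ℝ) / c)
  have hf : (k.factorial : ℝ) ≠ 0 := by positivity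
  rw [show c / (k.factorial : ℝ) * 1 * (k.factorial / c) = 1 by field_simp] at h4
  refine h4.congr' ?_
  filter_upwards [eventually_gt_atTop 3] with X hX
  have hG : Real.Gamma (aa n : ℝ) = k.factorial := by
    rw [hk]; push_cast; exact Real.Gamma_nat_eq_factorial k
  have he : Real.log X ^ ((aa n : ℝ) - 1) = Real.log X ^ k := by
    rw [hk]; push_cast; rw [add_sub_cancel_right, Real.rpow_natCast]
  have hL : 0 < Real.log X := Real.log_pos (by linarith)
  have hL3 : 0 < Real.log (X/3) := Real.log_pos (by linarith)
  rw [hG, he, badCount_eq]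
  simp only [Function.comp, id]
  push_cast
  generalize (∑ m ∈ Finset.Ioc 0 ⌊X/3⌋₊, (fn n m : ℝ)) = S
  have : X ≠ 0 := by linarith
  rw [div_pow]
  field_simp

lemma stmt_core (n : ℕ) (hn : 1 ≤ n) : ∃ c₀ : ℝ, 0 < c₀ ∧
    (Tendsto (fun N : ℕ => ∏ p ∈ (Finset.range (N + 1)).filter Nat.Prime,
      ((1 + (wn n p : ℝ) / p) * (1 - 1 / (p : ℝ)) ^ (((9 : ℝ) ^ n - 1) / 3 + ((27 : ℝ) ^ n - 1) / 6))) atTop (nhds c₀)) ∧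
    Tendsto (fun X : ℝ => (badCount n X : ℝ) /
      (2 * 27 ^ n * c₀ * X * Real.log X ^ (((9:ℝ)^n - 1)/3 + ((27:ℝ)^n - 1)/6 - 1) / (3 * Real.Gamma (((9:ℝ)^n - 1)/3 + ((27:ℝ)^n - 1)/6)))) atTop (nhds 1) := by
  obtain ⟨l, hl⟩ := (bA_PS n).converges
  obtain ⟨c, hc, rfl, h⟩ := euler_final n hl
  refine ⟨c, hc, ?_, ?_⟩
  · simp only [← aa_cast, Real.rpow_natCast]
    exact h
  · simp only [← aa_cast]
    exact main_asym n hn hc hl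

end

open Filter in
/-- With `α = (9^n − 1)/3 + (27^n − 1)/6`, the partial Euler products
`∏_{p ≤ N} (1 + w_n(p)/p)(1 − 1/p)^α` converge to a positive real `c₀`, and the number
of tuples in `𝒢_{n,bad}` with total product at most `X` is asymptotic, as `X → ∞`, to
`2 · 27^n · c₀ · X (log X)^{α−1} / (3 Γ(α))`. -/
theorem stmt_17 (n : ℕ) (hn : 1 ≤ n) :
    ∃ c₀ : ℝ, 0 < c₀ ∧
      (Tendsto (fun N : ℕ =>
          ∏ p ∈ (Finset.range (N + 1)).filter Nat.Prime,
            ((1 + (wn n p : ℝ) / p) *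
              (1 - 1 / (p : ℝ)) ^ (((9 : ℝ) ^ n - 1) / 3 + ((27 : ℝ) ^ n - 1) / 6)))
        atTop (nhds c₀)) ∧
      Tendsto (fun X : ℝ => (badCount n X : ℝ) /
          (2 * 27 ^ n * c₀ * X *
              Real.log X ^ (((9 : ℝ) ^ n - 1) / 3 + ((27 : ℝ) ^ n - 1) / 6 - 1) /
            (3 * Real.Gamma (((9 : ℝ) ^ n - 1) / 3 + ((27 : ℝ) ^ n - 1) / 6))))
        atTop (nhds 1) := by
  exact stmt_core n hn
end
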